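/- arXiv:2211.09482 — 2 statements merged into one kernel-verified Lean document; each statement's English description precedes it below -/
import Mathlib

section
/- Fix d ∈ ℕ, an abelian group G, and 0 < β, ε < 1, and set η = β^{d−1}ε/(2^d((d+1)!)²) and λ = η^{2^{d−1}} (so 0 < λ, η ≤ ε). Let X be a d-dimensional λ-local spectral expander whose links are β-coboundary expanders over G. For any cocycle f ∈ Z^k(X;G) with 1 ≤ k ≤ d−1, if ‖f‖ ≤ η^{2^{k+1}−1} and f is locally minimal, then supp(f) is (η,ε)-non-local. -/
/- Common framework: weighted simplicial complexes, links, localizations,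
   local spectral expansion, cochains, coboundaries, minimality, etc. -/

open Finset

open scoped Classical

namespace HDX

variable {V : Type*} [Fintype V] [DecidableEq V]

/-- The faces of cardinality `m` of a family of finite sets.  (A `k`-dimensional face
has cardinality `k+1`; the `(-1)`-face is the empty set, of cardinality `0`.) -/
def facesCard (Y : Finset (Finset V)) (m : ℕ) : Finset (Finset V) :=
  Y.filter fun s => s.card = m

/-- A simplicial complex: a downwards-closed family of finite sets. -/
def IsComplex (Y : Finset (Finset V)) : Prop :=
  ∀ σ ∈ Y, ∀ τ ⊆ σ, τ ∈ Y

/-- A (pure) `d`-dimensional complex: nonempty, all faces have at most `d+1` vertices, and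
every face is contained in a face with exactly `d+1` vertices (a top face). -/
def IsPureDim (Y : Finset (Finset V)) (d : ℕ) : Prop :=
  Y.Nonempty ∧ (∀ σ ∈ Y, σ.card ≤ d + 1) ∧ ∀ σ ∈ Y, ∃ τ ∈ Y, σ ⊆ τ ∧ τ.card = d + 1

/-- The weight `‖A‖` of a family `A` of faces of cardinality `m`, in a complex whose top
faces have cardinality `t`: pick a top face uniformly at random, then a uniformly random
subset of cardinality `m` of it, and take the probability that it lies in `A`. -/
noncomputable def wt (Y : Finset (Finset V)) (t m : ℕ) (A : Finset (Finset V)) : ℝ :=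
  (∑ σ ∈ facesCard Y t, (((σ.powersetCard m).filter (· ∈ A)).card : ℝ)) /
    (((facesCard Y t).card : ℝ) * (t.choose m : ℝ))

/-- The mutual weight `‖(A,B)‖` of `A` (faces of cardinality `m`) and `B` (faces of
cardinality `l`, `l ≤ m`): the probability that a random `m`-subset of a random top face is
in `A` and a further uniformly random `l`-subset of it is in `B`. -/
noncomputable def mwt (Y : Finset (Finset V)) (t m l : ℕ) (A B : Finset (Finset V)) : ℝ :=
  (∑ σ ∈ facesCard Y t, ∑ τ ∈ (σ.powersetCard m).filter (· ∈ A),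
      (((τ.powersetCard l).filter (· ∈ B)).card : ℝ)) /
    (((facesCard Y t).card : ℝ) * (t.choose m : ℝ) * (m.choose l : ℝ))

/-- Localization of a family `A` to (the link of) a face `σ`:
`A_σ = {τ \ σ | σ ⊆ τ ∈ A}`. -/
def localize (A : Finset (Finset V)) (σ : Finset V) : Finset (Finset V) :=
  (A.filter fun τ => σ ⊆ τ).image fun τ => τ \ σ

/-- The link `X_σ = {τ \ σ | σ ⊆ τ ∈ X}` of a face `σ`. -/
def link (Y : Finset (Finset V)) (σ : Finset V) : Finset (Finset V) :=
  localize Y σ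

/-- `locWt Y t A m σ` is the weight `‖A_σ‖` of the localization to the link of `σ` of the
family `A` of faces of cardinality `m`, where `Y` has top faces of cardinality `t`. -/
noncomputable def locWt (Y : Finset (Finset V)) (t : ℕ) (A : Finset (Finset V)) (m : ℕ)
    (σ : Finset V) : ℝ :=
  wt (link Y σ) (t - σ.card) (m - σ.card) (localize A σ)

/-- `w` is (the weight function of) a weighted graph which is a `λ`-spectral expander:
for every function orthogonal to the constants (in the weighted inner product) the Rayleigh
quotient of the normalized adjacency operator is at most `λ` in absolute value. -/
def IsSpectralExpanderW (w : V → V → ℝ) (lam : ℝ) : Prop :=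
  ∀ f : V → ℝ, (∑ u, (∑ v, w u v) * f u) = 0 →
    |∑ u, ∑ v, w u v * f u * f v| ≤ lam * ∑ u, (∑ v, w u v) * f u ^ 2

/-- The weight of the edge `{u,v}` in the underlying weighted graph of a complex with top
faces of cardinality `t`. -/
noncomputable def edgeWt (Y : Finset (Finset V)) (t : ℕ) (u v : V) : ℝ :=
  if u ≠ v then wt Y t 2 {({u, v} : Finset V)} else 0

/-- `λ`-local spectral expander: the underlying weighted graph of the link of every face of
dimension at most `d-2` (including the empty face) is a `λ`-spectral expander. -/
def IsLocalSpectralExpander (Y : Finset (Finset V)) (d : ℕ) (lam : ℝ) : Prop :=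
  ∀ σ ∈ Y, σ.card + 2 ≤ d + 1 →
    IsSpectralExpanderW (edgeWt (link Y σ) (d + 1 - σ.card)) lam

/-- `q`-bounded degree: every vertex is contained in at most `q` top faces. -/
def IsBoundedDegree (Y : Finset (Finset V)) (d q : ℕ) : Prop :=
  ∀ v : V, ((facesCard Y (d + 1)).filter fun σ => v ∈ σ).card ≤ q

/-- The skeleton consisting of the faces with at most `m` vertices
(i.e. of dimension at most `m - 1`). -/
def skeleton (Y : Finset (Finset V)) (m : ℕ) : Finset (Finset V) :=
  Y.filter fun σ => σ.card ≤ m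

/-- `δ₁(A)`: the faces of cardinality `m+1` that contain exactly one member of `A`
(a family of faces of cardinality `m`). -/
def delta1 (Y : Finset (Finset V)) (m : ℕ) (A : Finset (Finset V)) : Finset (Finset V) :=
  (facesCard Y (m + 1)).filter fun τ => ((τ.powersetCard m).filter (· ∈ A)).card = 1

/-- For `A ⊆ X(k)`, the set `S_{k-1}` of `(k-1)`-faces `σ` with `‖A_σ‖ ≤ η`. -/
noncomputable def nonlocalS (Y : Finset (Finset V)) (t k : ℕ) (A : Finset (Finset V))
    (η : ℝ) : Finset (Finset V) :=
  (facesCard Y k).filter fun σ => locWt Y t A (k + 1) σ ≤ η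

/-- `A ⊆ X(k)` is `(η,ε)`-non-local if `‖(A, S_{k-1})‖ ≥ (1-ε)‖A‖`. -/
def IsNonlocal (Y : Finset (Finset V)) (t k : ℕ) (A : Finset (Finset V)) (η ε : ℝ) : Prop :=
  mwt Y t (k + 1) k A (nonlocalS Y t k A η) ≥ (1 - ε) * wt Y t (k + 1) A

/-- For `A ⊆ X(k)`, the set `S_{k-2}` of `(k-2)`-faces `σ` with `‖A_σ‖ ≤ η`. -/
noncomputable def weakS (Y : Finset (Finset V)) (t k : ℕ) (A : Finset (Finset V))
    (η : ℝ) : Finset (Finset V) :=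
  (facesCard Y (k - 1)).filter fun σ => locWt Y t A (k + 1) σ ≤ η

/-- `A ⊆ X(k)` is `(η,ε,α)`-weakly-non-local if `‖S_{k-2}‖ ≥ 1 - ε‖A‖` and `‖A_τ‖ ≤ 1-α`
for every `(k-1)`-face `τ`. -/
def IsWeaklyNonlocal (Y : Finset (Finset V)) (t k : ℕ) (A : Finset (Finset V))
    (η ε α : ℝ) : Prop :=
  wt Y t (k - 1) (weakS Y t k A η) ≥ 1 - ε * wt Y t (k + 1) A ∧
    ∀ τ ∈ facesCard Y k, locWt Y t A (k + 1) τ ≤ 1 - α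

section Abelian

variable {G : Type*} [AddCommGroup G]

/-- An ordered face of the complex: an injective tuple whose image is a face. -/
def IsFaceTup (Y : Finset (Finset V)) {m : ℕ} (tup : Fin m → V) : Prop :=
  Function.Injective tup ∧ Finset.image tup Finset.univ ∈ Y

/-- A cochain over an abelian group `G` on the faces with `m` vertices (i.e. an
`(m-1)`-dimensional cochain): an antisymmetric `G`-valued function on ordered faces,
vanishing on tuples which are not ordered faces. -/
def IsCochain (Y : Finset (Finset V)) {m : ℕ} (f : (Fin m → V) → G) : Prop :=
  (∀ (tup : Fin m → V) (π : Equiv.Perm (Fin m)),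
      f (tup ∘ π) = ((Equiv.Perm.sign π : ℤˣ) : ℤ) • f tup) ∧
    ∀ tup : Fin m → V, ¬IsFaceTup Y tup → f tup = 0

/-- The coboundary operator `δ(f)(v_0,…,v_m) = ∑ i, (-1)^i f(v_0,…,v_{i-1},v_{i+1},…,v_m)`. -/
def cob {m : ℕ} (f : (Fin m → V) → G) : (Fin (m + 1) → V) → G := fun tup =>
  ∑ i : Fin (m + 1), ((-1 : ℤ) ^ (i : ℕ)) • f (tup ∘ i.succAbove)

/-- The support of `f`: the faces (with `m` vertices) on which `f` does not vanish. -/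
noncomputable def suppC (Y : Finset (Finset V)) {m : ℕ} (f : (Fin m → V) → G) :
    Finset (Finset V) :=
  (facesCard Y m).filter fun σ =>
    ∃ tup : Fin m → V, Finset.image tup Finset.univ = σ ∧ f tup ≠ 0

/-- The norm `‖f‖` of a cochain: the weight of its support. -/
noncomputable def normC (Y : Finset (Finset V)) (t : ℕ) {m : ℕ} (f : (Fin m → V) → G) : ℝ :=
  wt Y t m (suppC Y f)

/-- A cocycle: a cochain whose coboundary vanishes on all (ordered) faces. -/
def IsCocycle (Y : Finset (Finset V)) {m : ℕ} (f : (Fin m → V) → G) : Prop :=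
  IsCochain Y f ∧ ∀ tup : Fin (m + 1) → V, IsFaceTup Y tup → cob f tup = 0

/-- A coboundary: a function agreeing on all ordered faces with the coboundary of a cochain
of one dimension below. -/
def IsCoboundaryFn (Y : Finset (Finset V)) {m : ℕ} (f : (Fin (m + 1) → V) → G) : Prop :=
  ∃ g : (Fin m → V) → G, IsCochain Y g ∧
    ∀ tup : Fin (m + 1) → V, IsFaceTup Y tup → f tup = cob g tup

/-- The distance of `f` from the coboundaries. -/
noncomputable def distB (Y : Finset (Finset V)) (t : ℕ) {m : ℕ}
    (f : (Fin (m + 1) → V) → G) : ℝ :=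
  sInf {r : ℝ | ∃ g : (Fin m → V) → G, IsCochain Y g ∧
    r = normC Y t fun tup => f tup - cob g tup}

/-- The distance of `f` from the cocycles. -/
noncomputable def distZ (Y : Finset (Finset V)) (t : ℕ) {m : ℕ}
    (f : (Fin m → V) → G) : ℝ :=
  sInf {r : ℝ | ∃ g : (Fin m → V) → G, IsCocycle Y g ∧
    r = normC Y t fun tup => f tup - g tup}

/-- A minimal cochain: its weight cannot be decreased by adding a coboundary. -/
def IsMinimal (Y : Finset (Finset V)) (t : ℕ) {m : ℕ} (f : (Fin (m + 1) → V) → G) : Prop :=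
  ∀ g : (Fin m → V) → G, IsCochain Y g →
    normC Y t f ≤ normC Y t fun tup => f tup - cob g tup

/-- The localization `f_v` of a cochain to the link of a vertex `v`: `f_v(τ) = f(vτ)`. -/
def localizeC {m : ℕ} (f : (Fin (m + 1) → V) → G) (v : V) : (Fin m → V) → G :=
  fun tup => f (Fin.cons v tup)

/-- A locally minimal cochain: all its localizations to links of vertices are minimal. -/
def IsLocallyMinimal (Y : Finset (Finset V)) (t : ℕ) {m : ℕ}
    (f : (Fin (m + 2) → V) → G) : Prop :=
  ∀ v : V, ({v} : Finset V) ∈ Y → IsMinimal (link Y {v}) (t - 1) (localizeC f v)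

/-- A `β`-coboundary expander over `G` (for a complex with top faces of cardinality `t`):
for every dimension below the dimension of the complex, every cochain which is not a
coboundary satisfies `‖δ(f)‖ ≥ β · dist(f, B)`. -/
def IsCoboundaryExpander (Y : Finset (Finset V)) (t : ℕ) (G : Type*) [AddCommGroup G]
    (β : ℝ) : Prop :=
  ∀ m : ℕ, m + 2 ≤ t → ∀ f : (Fin (m + 1) → V) → G, IsCochain Y f → ¬IsCoboundaryFn Y f →
    normC Y t (cob f) ≥ β * distB Y t f

/-- The links (of all nonempty faces) of `Y` are `β`-coboundary expanders over `G`. -/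
def HasCobExpandingLinks (Y : Finset (Finset V)) (d : ℕ) (G : Type*) [AddCommGroup G]
    (β : ℝ) : Prop :=
  ∀ σ ∈ Y, σ.Nonempty → IsCoboundaryExpander (link Y σ) (d + 1 - σ.card) G β

/-- For a family `A` of faces with `c` vertices (i.e. `A ⊆ X(k)` with `c = k+1`),
`Sbar Y t c A η r` is the set `S̄_{k-1-r}` of "fat" faces of cardinality `c-1-r`:
`S̄_{k-1} = {σ ∈ X(k-1) : ‖A_σ‖ > η}` and, going down,
`S̄_i = {σ ∈ X(i) : ‖(S̄_{i+1})_σ‖ > η^{2^{k-i-1}}}`. -/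
noncomputable def Sbar (Y : Finset (Finset V)) (t c : ℕ) (A : Finset (Finset V)) (η : ℝ) :
    ℕ → Finset (Finset V)
  | 0 => (facesCard Y (c - 1)).filter fun σ => η < locWt Y t A c σ
  | r + 1 =>
      (facesCard Y (c - 1 - (r + 1))).filter fun σ =>
        η ^ 2 ^ (r + 1) < locWt Y t (Sbar Y t c A η r) (c - 1 - r) σ

/-- `Υ`: the set of `(k+1)`-faces (cardinality `c+1`, where `c = k+1`) containing two
`i`-faces `σ, σ' ∈ S̄_i` (for some `i ≥ 0`) with `σ ∪ σ' ∈ X(i+1)` and `σ ∩ σ' ∈ S_{i-1}`. -/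
noncomputable def Upsilon (Y : Finset (Finset V)) (t c : ℕ) (A : Finset (Finset V))
    (η : ℝ) : Finset (Finset V) :=
  (facesCard Y (c + 1)).filter fun τ => ∃ r : ℕ, r + 2 ≤ c ∧
    ∃ σ ∈ Sbar Y t c A η r, ∃ σ' ∈ Sbar Y t c A η r, σ ⊆ τ ∧ σ' ⊆ τ ∧
      σ ∪ σ' ∈ facesCard Y (c - r) ∧
      σ ∩ σ' ∈ facesCard Y (c - 2 - r) \ Sbar Y t c A η (r + 1)

/-- `f↓σ` (for `σ` of cardinality `c-1-r`, i.e. an `(k-r)`-dimensional... face): the members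
`τ` of `A` admitting a chain of containments `τ ⊃ τ_{k-1} ⊃ ⋯ ⊃ τ_{i+1} ⊃ σ` with each
`τ_j ∈ S̄_j`. -/
noncomputable def fdown (Y : Finset (Finset V)) (t c : ℕ) (A : Finset (Finset V)) (η : ℝ) :
    ℕ → Finset V → Finset (Finset V)
  | 0, σ => A.filter fun τ => σ ⊆ τ
  | r + 1, σ =>
      A.filter fun τ => ∃ τ' ∈ Sbar Y t c A η r, σ ⊆ τ' ∧ τ' ≠ σ ∧ τ ∈ fdown Y t c A η r τ'

end Abelian

section NonAbelian

variable {G : Type*} [Group G]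

/-- A 0-cochain over a (possibly non-abelian) group: vanishes on non-vertices. -/
def IsC0 (Y : Finset (Finset V)) (f : V → G) : Prop :=
  ∀ v : V, ({v} : Finset V) ∉ Y → f v = 1

/-- A 1-cochain over a (possibly non-abelian) group: antisymmetric, supported on edges. -/
def IsC1 (Y : Finset (Finset V)) (g : V → V → G) : Prop :=
  (∀ u v : V, g v u = (g u v)⁻¹) ∧
    ∀ u v : V, ({u, v} : Finset V) ∉ Y ∨ u = v → g u v = 1

/-- A 2-cochain over a (possibly non-abelian) group: antisymmetric, supported on triangles. -/
def IsC2 (Y : Finset (Finset V)) (f : V → V → V → G) : Prop :=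
  (∀ u v w : V, f u v w = f v w u) ∧ (∀ u v w : V, f v u w = (f u v w)⁻¹) ∧
    ∀ u v w : V, ({u, v, w} : Finset V) ∉ Y ∨ u = v ∨ u = w ∨ v = w → f u v w = 1

/-- The coboundary of a 0-cochain: `δ(f)(u,v) = f(u)·f(v)⁻¹`. -/
def d0 (f : V → G) : V → V → G := fun u v => f u * (f v)⁻¹

/-- The coboundary of a 1-cochain: `δ(g)(u,v,w) = g(u,v)·g(v,w)·g(w,u)`. -/
def d1 (g : V → V → G) : V → V → V → G := fun u v w => g u v * g v w * g w u

/-- The support (a set of vertices, as singleton faces) of a `G`-valued function. -/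
noncomputable def supp0 (Y : Finset (Finset V)) (f : V → G) : Finset (Finset V) :=
  (facesCard Y 1).filter fun s => ∃ v : V, ({v} : Finset V) = s ∧ f v ≠ 1

/-- The support (a set of edges) of a `G`-valued function on ordered edges. -/
noncomputable def supp1 (Y : Finset (Finset V)) (g : V → V → G) : Finset (Finset V) :=
  (facesCard Y 2).filter fun e => ∃ u v : V, ({u, v} : Finset V) = e ∧ u ≠ v ∧ g u v ≠ 1

/-- The support (a set of triangles) of a `G`-valued function on ordered triangles. -/
noncomputable def supp2 (Y : Finset (Finset V)) (f : V → V → V → G) : Finset (Finset V) :=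
  (facesCard Y 3).filter fun s =>
    ∃ u v w : V, ({u, v, w} : Finset V) = s ∧ u ≠ v ∧ u ≠ w ∧ v ≠ w ∧ f u v w ≠ 1

/-- The action of 0-cochains on 1-cochains: `h.g(u,v) = h(u)·g(u,v)·h(v)⁻¹`. -/
def act (h : V → G) (g : V → V → G) : V → V → G := fun u v => h u * g u v * (h v)⁻¹

/-- The norm of a 1-cochain: the weight of its support. -/
noncomputable def norm1 (Y : Finset (Finset V)) (t : ℕ) (g : V → V → G) : ℝ :=
  wt Y t 2 (supp1 Y g)

/-- The norm of a 2-cochain: the weight of its support. -/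
noncomputable def norm2 (Y : Finset (Finset V)) (t : ℕ) (f : V → V → V → G) : ℝ :=
  wt Y t 3 (supp2 Y f)

/-- The distance between two 1-cochains: `dist(g,g') = ‖g'g⁻¹‖`. -/
noncomputable def dist1 (Y : Finset (Finset V)) (t : ℕ) (g g' : V → V → G) : ℝ :=
  norm1 Y t fun u v => g' u v * (g u v)⁻¹

/-- A minimal 1-cochain: its weight cannot be decreased by acting with a 0-cochain. -/
def Minimal1 (Y : Finset (Finset V)) (t : ℕ) (g : V → V → G) : Prop :=
  ∀ h : V → G, IsC0 Y h → norm1 Y t g ≤ norm1 Y t (act h g)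

/-- The localization `f_v` of a 2-cochain to the link of `v`: `f_v(u,w) = f(v,u,w)`. -/
def locC1 (f : V → V → V → G) (v : V) : V → V → G := fun u w => f v u w

/-- A locally minimal 2-cochain: all its localizations to links of vertices are minimal. -/
def LocallyMinimal2 (Y : Finset (Finset V)) (t : ℕ) (f : V → V → V → G) : Prop :=
  ∀ v : V, ({v} : Finset V) ∈ Y → Minimal1 (link Y {v}) (t - 1) (locC1 f v)

/-- A 1-coboundary: `g = δ(h)` on the edges, for some 0-cochain `h`. -/
def IsCoboundary1 (Y : Finset (Finset V)) (g : V → V → G) : Prop :=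
  ∃ h : V → G, IsC0 Y h ∧
    ∀ u v : V, ({u, v} : Finset V) ∈ Y → u ≠ v → g u v = h u * (h v)⁻¹

/-- A 1-cocycle: a 1-cochain whose coboundary is trivial on all triangles. -/
def IsCocycle1 (Y : Finset (Finset V)) (g : V → V → G) : Prop :=
  IsC1 Y g ∧ ∀ u v w : V, ({u, v, w} : Finset V) ∈ Y → u ≠ v → u ≠ w → v ≠ w →
    d1 g u v w = 1

/-- A constant 0-cochain (member of `B⁰`). -/
def IsConst0 (Y : Finset (Finset V)) (f : V → G) : Prop :=
  ∃ c : G, ∀ v : V, ({v} : Finset V) ∈ Y → f v = c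

/-- The distance of a 0-cochain from `B⁰` (the constants). -/
noncomputable def distB0 (Y : Finset (Finset V)) (t : ℕ) (f : V → G) : ℝ :=
  sInf {r : ℝ | ∃ c : G, r = wt Y t 1 (supp0 Y fun v => f v * c⁻¹)}

/-- The distance of a 1-cochain from the 1-coboundaries. -/
noncomputable def distB1 (Y : Finset (Finset V)) (t : ℕ) (g : V → V → G) : ℝ :=
  sInf {r : ℝ | ∃ h : V → G, IsC0 Y h ∧ r = dist1 Y t g (act h g)}

/-- The distance of a 1-cochain from the 1-cocycles. -/
noncomputable def distZ1 (Y : Finset (Finset V)) (t : ℕ) (g : V → V → G) : ℝ :=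
  sInf {r : ℝ | ∃ g' : V → V → G, IsCocycle1 Y g' ∧ r = dist1 Y t g g'}

/-- A `β`-coboundary expander over a (possibly non-abelian) group `G`, for a complex with top
faces of cardinality `t`: in every dimension (0 and 1) below the dimension of the complex,
every cochain which is not a coboundary satisfies `‖δ(f)‖ ≥ β·dist(f,B)`. -/
def CobExpanderNA (Y : Finset (Finset V)) (t : ℕ) (G : Type*) [Group G] (β : ℝ) : Prop :=
  (2 ≤ t → ∀ f : V → G, IsC0 Y f → ¬IsConst0 Y f →
      norm1 Y t (d0 f) ≥ β * distB0 Y t f) ∧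
    (3 ≤ t → ∀ g : V → V → G, IsC1 Y g → ¬IsCoboundary1 Y g →
      norm2 Y t (d1 g) ≥ β * distB1 Y t g)

/-- The links (of all nonempty faces) of `Y` are `β`-coboundary expanders over `G`. -/
def HasCobExpandingLinksNA (Y : Finset (Finset V)) (d : ℕ) (G : Type*) [Group G]
    (β : ℝ) : Prop :=
  ∀ σ ∈ Y, σ.Nonempty → CobExpanderNA (link Y σ) (d + 1 - σ.card) G β

end NonAbelian

end HDX

set_option linter.unusedSectionVars false

namespace HDXP
open HDX
variable {V : Type*} [Fintype V] [DecidableEq V]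

/-- number of top faces containing `s` -/
noncomputable def w (Y : Finset (Finset V)) (t : ℕ) (s : Finset V) : ℝ :=
  (((facesCard Y t).filter (fun ρ => s ⊆ ρ)).card : ℝ)

lemma w_nonneg (Y : Finset (Finset V)) (t : ℕ) (s : Finset V) : 0 ≤ w Y t s := Nat.cast_nonneg _

lemma w_empty (Y : Finset (Finset V)) (t : ℕ) : w Y t ∅ = ((facesCard Y t).card : ℝ) := by
  simp [w]

lemma w_sum (Y : Finset (Finset V)) (t : ℕ) (s : Finset V) :
    w Y t s = ∑ ρ ∈ facesCard Y t, if s ⊆ ρ then (1 : ℝ) else 0 := by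
  simp [w]

lemma wt_eq (Y : Finset (Finset V)) (t m : ℕ) (A : Finset (Finset V)) (hA : ∀ s ∈ A, s.card = m) :
    wt Y t m A = (∑ s ∈ A, w Y t s) / (w Y t ∅ * (t.choose m : ℝ)) := by
  unfold wt
  rw [w_empty]
  congr 1
  simp_rw [w_sum]
  rw [Finset.sum_comm]
  refine Finset.sum_congr rfl fun ρ _ => ?_
  rw [Finset.sum_boole]
  congr 2
  ext s
  simp only [mem_filter, mem_powersetCard]
  constructor
  · rintro ⟨⟨h1, h2⟩, h3⟩; exact ⟨h3, h1⟩
  · rintro ⟨h1, h2⟩; exact ⟨⟨h2, hA s h1⟩, h1⟩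

lemma mwt_eq (Y : Finset (Finset V)) (t m l : ℕ) (A B : Finset (Finset V))
    (hA : ∀ s ∈ A, s.card = m) :
    mwt Y t m l A B = (∑ s ∈ A, w Y t s * (((s.powersetCard l).filter (· ∈ B)).card : ℝ)) /
      (w Y t ∅ * (t.choose m : ℝ) * (m.choose l : ℝ)) := by
  unfold mwt
  rw [w_empty]
  congr 1
  simp_rw [w_sum, Finset.sum_mul]
  rw [Finset.sum_comm]
  refine Finset.sum_congr rfl fun ρ _ => ?_
  simp_rw [ite_mul, one_mul, zero_mul]
  rw [← Finset.sum_filter]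
  refine Finset.sum_congr ?_ fun _ _ => rfl
  ext s
  simp only [mem_filter, mem_powersetCard]
  constructor
  · rintro ⟨⟨h1, h2⟩, h3⟩; exact ⟨h3, h1⟩
  · rintro ⟨h1, h2⟩; exact ⟨⟨h2, hA s h1⟩, h1⟩

lemma mem_localize {A : Finset (Finset V)} {σ τ : Finset V} :
    τ ∈ localize A σ ↔ Disjoint τ σ ∧ τ ∪ σ ∈ A := by
  unfold localize
  simp only [mem_image, mem_filter]
  constructor
  · rintro ⟨ρ, ⟨h1, h2⟩, rfl⟩
    exact ⟨sdiff_disjoint, by rwa [sdiff_union_of_subset h2]⟩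
  · rintro ⟨h1, h2⟩
    exact ⟨τ ∪ σ, ⟨h2, subset_union_right⟩, by
      rw [union_sdiff_right, sdiff_eq_self_of_disjoint h1]⟩

lemma mem_link {A : Finset (Finset V)} {σ τ : Finset V} :
    τ ∈ link A σ ↔ Disjoint τ σ ∧ τ ∪ σ ∈ A := mem_localize

lemma mem_facesCard {Y : Finset (Finset V)} {m : ℕ} {s : Finset V} :
    s ∈ facesCard Y m ↔ s ∈ Y ∧ s.card = m := by simp [facesCard]

lemma w_link (Y : Finset (Finset V)) (t : ℕ) (σ s : Finset V) (hσ : σ.card ≤ t)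
    (hs : Disjoint s σ) : w (link Y σ) (t - σ.card) s = w Y t (s ∪ σ) := by
  unfold w
  congr 1
  refine Finset.card_bij (fun ρ _ => ρ ∪ σ) ?_ ?_ ?_
  · intro ρ h
    simp only [mem_filter, mem_facesCard, mem_link] at h ⊢
    obtain ⟨⟨⟨h1, h2⟩, h3⟩, h4⟩ := h
    refine ⟨⟨h2, ?_⟩, union_subset_union_left h4⟩
    rw [card_union_of_disjoint h1]; omega
  · intro ρ h ρ' h' e
    simp only [mem_filter, mem_facesCard, mem_link] at h h'
    have := congrArg (· \ σ) e
    simpa [union_sdiff_right, sdiff_eq_self_of_disjoint h.1.1.1,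
      sdiff_eq_self_of_disjoint h'.1.1.1] using this
  · intro ρ h
    simp only [mem_filter, mem_facesCard] at h
    have hσρ : σ ⊆ ρ := subset_union_right.trans h.2
    refine ⟨ρ \ σ, ?_, sdiff_union_of_subset hσρ⟩
    simp only [mem_filter, mem_facesCard, mem_link]
    refine ⟨⟨⟨sdiff_disjoint, by rw [sdiff_union_of_subset hσρ]; exact h.1.1⟩, ?_⟩, ?_⟩
    · rw [card_sdiff_of_subset hσρ, h.1.2]
    · exact subset_sdiff.2 ⟨subset_union_left.trans h.2, hs⟩

lemma w_link_zero (Y : Finset (Finset V)) (t : ℕ) (σ s : Finset V) (hs : ¬ Disjoint s σ) :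
    w (link Y σ) t s = 0 := by
  unfold w
  norm_cast
  rw [Finset.card_eq_zero, Finset.filter_eq_empty_iff]
  intro ρ h h2
  simp only [mem_facesCard, mem_link] at h
  exact hs (disjoint_of_subset_left h2 h.1.1)

/-- normalized sum for localization -/
lemma locWt_eq (Y : Finset (Finset V)) (t m : ℕ) (A : Finset (Finset V)) (σ : Finset V)
    (hσ : σ.card ≤ t) (hA : ∀ s ∈ A, s.card = m) :
    locWt Y t A m σ = (∑ s ∈ A.filter (fun s => σ ⊆ s), w Y t s) /
      (w Y t σ * ((t - σ.card).choose (m - σ.card) : ℝ)) := by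
  unfold locWt
  rw [wt_eq]
  · rw [w_link _ _ _ _ hσ (disjoint_empty_left _), empty_union]
    congr 1
    refine Finset.sum_bij (fun s _ => s ∪ σ) ?_ ?_ ?_ ?_
    · intro s hs
      rw [mem_localize] at hs
      exact mem_filter.2 ⟨hs.2, subset_union_right⟩
    · intro s h s' h' e
      rw [mem_localize] at h h'
      have := congrArg (· \ σ) e
      simpa [union_sdiff_right, sdiff_eq_self_of_disjoint h.1,
        sdiff_eq_self_of_disjoint h'.1] using this
    · intro s hs
      rw [mem_filter] at hs
      refine ⟨s \ σ, ?_, sdiff_union_of_subset hs.2⟩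
      rw [mem_localize, sdiff_union_of_subset hs.2]
      exact ⟨sdiff_disjoint, hs.1⟩
    · intro s hs
      rw [mem_localize] at hs
      exact w_link _ _ _ _ hσ hs.1
  · intro s hs
    rw [mem_localize] at hs
    have := hA _ hs.2
    rw [card_union_of_disjoint hs.1] at this
    omega

lemma sum_ext (Y : Finset (Finset V)) (t n : ℕ) (p : Finset V) (hn : p.card ≤ n) :
    ∑ ρ ∈ univ.filter (fun ρ : Finset V => p ⊆ ρ ∧ ρ.card = n), w Y t ρ =
      w Y t p * ((t - p.card).choose (n - p.card) : ℝ) := by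
  simp_rw [w_sum, Finset.sum_mul]
  rw [Finset.sum_comm]
  refine Finset.sum_congr rfl fun σ hσ => ?_
  rw [mem_facesCard] at hσ
  rw [Finset.sum_boole, Finset.filter_filter]
  split_ifs with h
  · rw [one_mul]
    rw [← hσ.2, ← card_sdiff_of_subset h, ← card_powersetCard]
    congr 1
    refine Finset.card_bij (fun ρ _ => ρ \ p) ?_ ?_ ?_
    · intro ρ hρ
      simp only [mem_filter, mem_univ, true_and] at hρ
      rw [mem_powersetCard, card_sdiff_of_subset hρ.1.1, hρ.1.2]
      exact ⟨sdiff_subset_sdiff hρ.2 (le_refl _), rfl⟩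
    · intro ρ hρ ρ' hρ' e
      simp only [mem_filter, mem_univ, true_and] at hρ hρ'
      rw [← sdiff_union_of_subset hρ.1.1, ← sdiff_union_of_subset hρ'.1.1]
      exact congrArg (· ∪ p) e
    · intro s hs
      rw [mem_powersetCard] at hs
      have hd : Disjoint s p := (subset_sdiff.1 hs.1).2
      refine ⟨s ∪ p, ?_, by rw [union_sdiff_right, sdiff_eq_self_of_disjoint hd]⟩
      simp only [mem_filter, mem_univ, true_and]
      refine ⟨⟨subset_union_right, ?_⟩, union_subset (hs.1.trans sdiff_subset) h⟩
      rw [card_union_of_disjoint hd, hs.2]; omega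
  · rw [zero_mul]
    norm_cast
    rw [Finset.card_eq_zero, Finset.filter_eq_empty_iff]
    rintro ρ - ⟨⟨h1, h2⟩, h3⟩
    exact h (h1.trans h3)

lemma sum_ext1 (Y : Finset (Finset V)) (t : ℕ) (p : Finset V) :
    ∑ v ∈ univ.filter (fun v : V => v ∉ p), w Y t (insert v p) =
      w Y t p * ((t - p.card : ℕ) : ℝ) := by
  have := sum_ext Y t (p.card + 1) p (Nat.le_succ _)
  rw [Nat.add_sub_cancel_left, Nat.choose_one_right] at this
  rw [← this]
  refine Finset.sum_bij (fun v _ => insert v p) ?_ ?_ ?_ (fun _ _ => rfl)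
  · intro v hv
    simp only [mem_filter, mem_univ, true_and] at hv ⊢
    exact ⟨subset_insert _ _, card_insert_of_notMem hv⟩
  · intro v hv v' hv' e
    simp only [mem_filter, mem_univ, true_and] at hv hv'
    exact (insert_inj hv).1 e
  · intro ρ hρ
    simp only [mem_filter, mem_univ, true_and] at hρ
    obtain ⟨v, hv, rfl⟩ := (covBy_iff_exists_insert.1
      (covBy_iff_card_sdiff_eq_one.2 ⟨hρ.1, by rw [card_sdiff_of_subset hρ.1]; omega⟩))
    exact ⟨v, by simpa using hv, rfl⟩

lemma w_pos {X : Finset (Finset V)} {d : ℕ} (hXd : IsPureDim X d) {s : Finset V} (hs : s ∈ X) :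
    0 < w X (d + 1) s := by
  obtain ⟨τ, h1, h2, h3⟩ := hXd.2.2 s hs
  unfold w
  norm_cast
  exact Finset.card_pos.2 ⟨τ, by simp [mem_facesCard, h1, h2, h3]⟩

lemma w_zero {X : Finset (Finset V)} (hX : IsComplex X) {t : ℕ} {s : Finset V} (hs : s ∉ X) :
    w X t s = 0 := by
  unfold w
  norm_cast
  rw [Finset.card_eq_zero, Finset.filter_eq_empty_iff]
  intro ρ h h2
  exact hs (hX ρ (mem_facesCard.1 h).1 s h2)

end HDXP

namespace HDXP
open HDX
variable {V : Type*} [Fintype V] [DecidableEq V]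

/-- fat faces, indexed by codimension -/
noncomputable def S (X : Finset (Finset V)) (t c : ℕ) (A : Finset (Finset V)) (η : ℝ) :
    ℕ → Finset (Finset V)
  | 0 => A
  | r + 1 => (facesCard X (c - (r + 1))).filter fun σ =>
      η ^ 2 ^ r * (w X t σ * ((t - (c - (r + 1)) : ℕ) : ℝ)) <
        ∑ s ∈ (S X t c A η r).filter (fun s => σ ⊆ s), w X t s

def Ch (X : Finset (Finset V)) (t c : ℕ) (A : Finset (Finset V)) (η : ℝ) :
    ℕ → Finset V → Finset V → Prop
  | 0, s, σ => s = σ ∧ s ∈ A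
  | r + 1, s, σ => σ ∈ S X t c A η (r + 1) ∧ ∃ τ ∈ S X t c A η r, σ ⊆ τ ∧ Ch X t c A η r s τ

def Good (X : Finset (Finset V)) (t c : ℕ) (A : Finset (Finset V)) (η : ℝ) (ρ : Finset V) : Prop :=
  ∀ r < c, ∀ σ ∈ S X t c A η r, ∀ σ' ∈ S X t c A η r, σ ⊆ ρ → σ' ⊆ ρ → σ ≠ σ' →
    (σ ∪ σ').card = c - r + 1 → σ ∩ σ' ∈ S X t c A η (r + 1)

variable {X : Finset (Finset V)} {t c : ℕ} {A : Finset (Finset V)} {η : ℝ}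

lemma S_sub (hA : A ⊆ facesCard X c) (r : ℕ) : S X t c A η r ⊆ facesCard X (c - r) := by
  cases r with
  | zero => exact hA
  | succ r => exact filter_subset _ _

lemma S_card (hA : A ⊆ facesCard X c) {r : ℕ} {s : Finset V} (h : s ∈ S X t c A η r) :
    s.card = c - r := (mem_facesCard.1 (S_sub hA r h)).2

lemma S_mem (hA : A ⊆ facesCard X c) {r : ℕ} {s : Finset V} (h : s ∈ S X t c A η r) :
    s ∈ X := (mem_facesCard.1 (S_sub hA r h)).1

lemma Ch_S {r : ℕ} {s σ : Finset V} (h : Ch X t c A η r s σ) : σ ∈ S X t c A η r := by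
  cases r with
  | zero => obtain ⟨rfl, h⟩ := h; exact h
  | succ r => exact h.1

lemma Ch_A {r : ℕ} {s σ : Finset V} (h : Ch X t c A η r s σ) : s ∈ A ∧ σ ⊆ s := by
  induction r generalizing σ with
  | zero => obtain ⟨rfl, h⟩ := h; exact ⟨h, Subset.refl _⟩
  | succ r ih =>
    obtain ⟨_, τ, _, h2, h3⟩ := h
    exact ⟨(ih h3).1, h2.trans (ih h3).2⟩

lemma Ch_one {s σ : Finset V} : Ch X t c A η 1 s σ ↔ σ ∈ S X t c A η 1 ∧ s ∈ A ∧ σ ⊆ s := by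
  constructor
  · intro h; exact ⟨Ch_S h, Ch_A h⟩
  · rintro ⟨h1, h2, h3⟩
    exact ⟨h1, s, h2, h3, rfl, h2⟩

lemma chain_step (hA : A ⊆ facesCard X c) {ρ : Finset V} (hρ : ρ.card = c + 1)
    (hg : Good X t c A η ρ) {u : V} (hu : u ∈ ρ) (huA : ρ.erase u ∈ A)
    (hc : 0 < c) {r : ℕ} {s σ : Finset V} (hs : s ⊆ ρ) (h : Ch X t c A η r s σ) :
    (u ∈ σ → Ch X t c A η (r + 1) (ρ.erase u) (σ.erase u)) ∧
    (u ∉ σ → Ch X t c A η r (ρ.erase u) σ) := by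
  induction r generalizing σ with
  | zero =>
    obtain ⟨rfl, h⟩ := h
    have hsc : s.card = c := (mem_facesCard.1 (hA h)).2
    constructor
    · intro hus
      have hne : s ≠ ρ.erase u := fun e => by rw [e] at hus; simp at hus
      have hun : s ∪ ρ.erase u = ρ := by
        ext x
        simp only [mem_union, mem_erase]
        constructor
        · rintro (h | h)
          · exact hs h
          · exact h.2
        · intro hx
          by_cases hxu : x = u
          · left; rwa [hxu]
          · right; exact ⟨hxu, hx⟩
      have hint : s ∩ ρ.erase u = s.erase u := by
        ext x
        simp only [mem_inter, mem_erase]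
        constructor
        · rintro ⟨h1, h2, h3⟩; exact ⟨h2, h1⟩
        · rintro ⟨h1, h2⟩; exact ⟨h2, h1, hs h2⟩
      have := hg 0 hc s h _ huA hs (erase_subset _ _) hne (by rw [hun]; exact hρ)
      rw [hint] at this
      exact Ch_one.2 ⟨this, huA, erase_subset_erase _ hs⟩
    · intro hus
      have : s = ρ.erase u := by
        refine eq_of_subset_of_card_le (fun x hx => mem_erase.2 ⟨fun e => hus (e ▸ hx), hs hx⟩) ?_
        rw [card_erase_of_mem hu, hρ, hsc]; simp
      exact ⟨this.symm, huA⟩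
  | succ r ih =>
    obtain ⟨h1, τ, h2, h3, h4⟩ := h
    have hτρ : τ ⊆ ρ := (Ch_A h4).2.trans hs
    obtain ⟨i1, i2⟩ := ih h4
    have hσc := S_card hA h1
    have hτc := S_card hA h2
    by_cases huτ : u ∈ τ
    · have j1 := i1 huτ
      have hτpos : 0 < τ.card := card_pos.2 ⟨u, huτ⟩
      constructor
      · intro huσ
        have hσpos : 0 < σ.card := card_pos.2 ⟨u, huσ⟩
        have hne : σ ≠ τ.erase u := fun e => by rw [e] at huσ; simp at huσ
        have hun : σ ∪ τ.erase u = τ := by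
          ext x
          simp only [mem_union, mem_erase]
          constructor
          · rintro (h | h)
            · exact h3 h
            · exact h.2
          · intro hx
            by_cases hxu : x = u
            · left; rwa [hxu]
            · right; exact ⟨hxu, hx⟩
        have hint : σ ∩ τ.erase u = σ.erase u := by
          ext x
          simp only [mem_inter, mem_erase]
          constructor
          · rintro ⟨h1, h2, h3⟩; exact ⟨h2, h1⟩
          · rintro ⟨h1, h2⟩; exact ⟨h2, h1, h3 h2⟩
        have := hg (r + 1) (by omega) σ h1 _ (Ch_S j1) (h3.trans hτρ)
          ((erase_subset _ _).trans hτρ) hne (by rw [hun]; omega)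
        rw [hint] at this
        exact ⟨this, τ.erase u, Ch_S j1, erase_subset_erase _ h3, j1⟩
      · intro huσ
        have : σ = τ.erase u := by
          refine eq_of_subset_of_card_le
            (fun x hx => mem_erase.2 ⟨fun e => huσ (e ▸ hx), h3 hx⟩) ?_
          rw [card_erase_of_mem huτ]; omega
        rw [this]; exact j1
    · have huσ : u ∉ σ := fun h => huτ (h3 h)
      exact ⟨fun h => absurd h huσ, fun _ => ⟨h1, τ, h2, h3, i2 huτ⟩⟩

/-- weight of level sets -/
noncomputable def W (X : Finset (Finset V)) (t : ℕ) (B : Finset (Finset V)) : ℝ :=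
  ∑ s ∈ B, w X t s

lemma W_nonneg (B : Finset (Finset V)) : 0 ≤ W X t B := sum_nonneg fun _ _ => w_nonneg _ _ _

/-- number-of-subsets double counting -/
lemma sum_sub_le (B C : Finset (Finset V)) (n j : ℕ) (hB : ∀ s ∈ B, s.card = n)
    (hC : ∀ σ ∈ C, σ.card = j) :
    ∑ σ ∈ C, ∑ s ∈ B.filter (fun s => σ ⊆ s), w X t s ≤ (n.choose j : ℝ) * W X t B := by
  simp_rw [sum_filter]
  rw [sum_comm, W, mul_sum]
  refine sum_le_sum fun s hs => ?_
  rw [← sum_filter, sum_const, nsmul_eq_mul]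
  refine mul_le_mul_of_nonneg_right ?_ (w_nonneg _ _ _)
  rw [← hB s hs, ← card_powersetCard]
  norm_cast
  refine card_le_card fun σ hσ => ?_
  rw [mem_filter] at hσ
  exact mem_powersetCard.2 ⟨hσ.2, hC σ hσ.1⟩

lemma W_succ (hA : A ⊆ facesCard X c) (r : ℕ) (hr : r + 1 ≤ c) :
    η ^ 2 ^ r * ((t - (c - (r + 1)) : ℕ) : ℝ) * W X t (S X t c A η (r + 1)) ≤
      ((c - r : ℕ) : ℝ) * W X t (S X t c A η r) := by
  have h := sum_sub_le (X := X) (t := t) (S X t c A η r) (S X t c A η (r + 1)) (c - r) (c - (r + 1))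
    (fun s hs => S_card hA hs) (fun s hs => S_card hA hs)
  have e : (c - r).choose (c - (r + 1)) = c - r := by
    have : c - r = (c - (r+1)) + 1 := by omega
    rw [this, Nat.choose_succ_self_right]
  rw [e] at h
  refine le_trans ?_ h
  rw [W, mul_sum]
  refine sum_le_sum fun σ hσ => ?_
  have := (mem_filter.1 hσ).2
  refine le_trans (le_of_eq ?_) this.le
  ring

lemma W_bound (hA : A ⊆ facesCard X c) (hη : 0 < η) (hct : c ≤ t) (r : ℕ) (hr : r ≤ c) :
    η ^ (2 ^ r - 1) * W X t (S X t c A η r) * (t.choose c : ℝ) ≤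
      (t.choose (c - r) : ℝ) * W X t A := by
  induction r with
  | zero => simp [S]; linarith
  | succ r ih =>
    have ih := ih (by omega)
    have h1 := W_succ (X := X) (t := t) (η := η) hA r hr
    have hid : (t.choose (c - r) : ℝ) * ((c - r : ℕ) : ℝ)
        = t.choose (c - (r + 1)) * ((t - (c - (r + 1)) : ℕ) : ℝ) := by
      have := Nat.choose_succ_right_eq t (c - (r + 1))
      rw [show c - (r + 1) + 1 = c - r by omega] at this
      exact_mod_cast this
    have hpos : (0 : ℝ) < ((t - (c - (r + 1)) : ℕ) : ℝ) := by
      norm_cast; omega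
    have e : 2 ^ (r + 1) - 1 = (2 ^ r - 1) + 2 ^ r := by
      have := Nat.one_le_two_pow (n := r)
      rw [pow_succ]; omega
    rw [e, pow_add]
    refine le_of_mul_le_mul_right ?_ hpos
    have hp : 0 ≤ η ^ (2 ^ r - 1) := by positivity
    have hq : (0 : ℝ) ≤ t.choose c := by positivity
    have h2 := mul_le_mul_of_nonneg_right (mul_le_mul_of_nonneg_left h1 hp) hq
    have h3 := mul_le_mul_of_nonneg_left ih (show (0 : ℝ) ≤ ((c - r : ℕ) : ℝ) by positivity)
    calc _ = η ^ (2 ^ r - 1) * (η ^ 2 ^ r * ((t - (c - (r + 1)) : ℕ) : ℝ)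
              * W X t (S X t c A η (r + 1))) * (t.choose c : ℝ) := by ring
      _ ≤ _ := h2
      _ = ((c - r : ℕ) : ℝ) * (η ^ (2 ^ r - 1) * W X t (S X t c A η r) * (t.choose c : ℝ)) := by ring
      _ ≤ _ := h3
      _ = (t.choose (c - r) : ℝ) * ((c - r : ℕ) : ℝ) * W X t A := by ring
      _ = _ := by rw [hid]; ring

/-- the empty face is not fat -/
lemma S_top_empty (hA : A ⊆ facesCard X c) (hη : 0 < η) (hct : c ≤ t) (hc : 0 < c)
    (hsmall : W X t A ≤ η ^ (2 ^ c - 1) * (w X t ∅ * (t.choose c : ℝ))) :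
    S X t c A η c = ∅ := by
  obtain ⟨r, rfl⟩ : ∃ r, c = r + 1 := ⟨c - 1, by omega⟩
  rw [Finset.eq_empty_iff_forall_notMem]
  intro σ hσ
  have h0 := S_card hA hσ
  rw [Nat.sub_self, card_eq_zero] at h0
  subst h0
  have h := (mem_filter.1 hσ).2
  have hb := W_bound (X := X) (t := t) (η := η) hA hη hct r (by omega)
  have hle : ∑ s ∈ (S X t (r+1) A η r).filter (fun s => ∅ ⊆ s), w X t s ≤ W X t (S X t (r+1) A η r) := by
    simp [W]
  have h1 := h.trans_le hle
  rw [Nat.sub_self, Nat.sub_zero] at h1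
  rw [show r + 1 - r = 1 by omega, Nat.choose_one_right] at hb
  have hq : (0 : ℝ) < t.choose (r+1) := by exact_mod_cast Nat.choose_pos hct
  have hp : 0 < η ^ (2 ^ r - 1) := by positivity
  have ht : (0 : ℝ) < t := by norm_cast; omega
  have h2 := mul_lt_mul_of_pos_right (mul_lt_mul_of_pos_left h1 hp) hq
  have h3 := h2.trans_le hb
  have h4 := h3.trans_le (mul_le_mul_of_nonneg_left hsmall ht.le)
  have e : 2 ^ (r + 1) - 1 = (2 ^ r - 1) + 2 ^ r := by
    have := Nat.one_le_two_pow (n := r)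
    rw [pow_succ]; omega
  rw [e, pow_add] at h4
  exact absurd h4 (not_lt.2 (le_of_eq (by ring)))

end HDXP

namespace HDXP
open HDX
variable {V : Type*} [Fintype V] [DecidableEq V]

lemma mix_generic (e : V → V → ℝ) (lam : ℝ) (hlam : 0 ≤ lam) (hsymm : ∀ u v, e u v = e v u)
    (hpos : ∀ u v, 0 ≤ e u v) (hexp : IsSpectralExpanderW e lam) (B : Finset V)
    (vol : ℝ) (hvol : vol = ∑ u, ∑ v, e u v) (hvp : 0 < vol) :
    (∑ u ∈ B, ∑ v ∈ B, e u v) ≤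
      (∑ u ∈ B, ∑ v, e u v) * ((∑ u ∈ B, ∑ v, e u v) / vol + lam) := by
  set vB := ∑ u ∈ B, ∑ v, e u v with hvB
  have hvB0 : 0 ≤ vB := sum_nonneg fun _ _ => sum_nonneg fun _ _ => hpos _ _
  set b := vB / vol with hb
  have hbv : b * vol = vB := div_mul_cancel₀ _ hvp.ne'
  have hb0 : 0 ≤ b := by positivity
  set f : V → ℝ := fun u => (if u ∈ B then 1 else 0) - b with hf
  have s1 : ∑ u, (∑ v, e u v) * (if u ∈ B then (1:ℝ) else 0) = vB := by
    simp [hvB]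
  have s2 : ∑ u, ∑ v, e u v * (if v ∈ B then (1:ℝ) else 0) = vB := by
    rw [sum_comm, ← s1]
    refine sum_congr rfl fun u _ => ?_
    rw [sum_mul]
    exact sum_congr rfl fun v _ => by rw [hsymm]
  have s3 : ∑ u, ∑ v, e u v * (if u ∈ B then (1:ℝ) else 0) = vB := by
    rw [← s1]
    refine sum_congr rfl fun u _ => ?_
    rw [sum_mul]
  have s4 : ∑ u, ∑ v, e u v * ((if u ∈ B then (1:ℝ) else 0) * (if v ∈ B then (1:ℝ) else 0))
      = ∑ u ∈ B, ∑ v ∈ B, e u v := by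
    have : ∀ u, ∑ v, e u v * ((if u ∈ B then (1:ℝ) else 0) * (if v ∈ B then (1:ℝ) else 0)) =
        if u ∈ B then ∑ v ∈ B, e u v else 0 := by
      intro u
      split_ifs <;> simp
    simp_rw [this]
    simp
  have h0 : (∑ u, (∑ v, e u v) * f u) = 0 := by
    simp only [hf, mul_sub, sum_sub_distrib, s1]
    rw [← sum_mul, ← hvol]; linarith
  have h := hexp f h0
  have hA : ∑ u, ∑ v, e u v * f u * f v = (∑ u ∈ B, ∑ v ∈ B, e u v) - b * vB := by
    have : ∀ u v, e u v * f u * f v =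
        e u v * ((if u ∈ B then (1:ℝ) else 0) * (if v ∈ B then (1:ℝ) else 0))
        - b * (e u v * (if u ∈ B then (1:ℝ) else 0)) - b * (e u v * (if v ∈ B then (1:ℝ) else 0))
        + b ^ 2 * e u v := by
      intro u v; simp only [hf]; ring
    simp_rw [this, sum_add_distrib, sum_sub_distrib, ← mul_sum, s2, s3, s4, ← hvol]
    rw [pow_two, mul_assoc b b vol, hbv]; ring
  have hB : ∑ u, (∑ v, e u v) * f u ^ 2 = vB - b * vB := by
    have : ∀ u, (∑ v, e u v) * f u ^ 2 =
        (∑ v, e u v) * (if u ∈ B then (1:ℝ) else 0) * (1 - 2 * b) + b ^ 2 * (∑ v, e u v) := by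
      intro u; simp only [hf]; split_ifs <;> ring
    simp_rw [this, sum_add_distrib, ← sum_mul, ← mul_sum, s1, ← hvol]
    rw [pow_two, mul_assoc b b vol, hbv]; ring
  rw [hA, hB] at h
  have h' := (le_abs_self _).trans h
  have : 0 ≤ lam * (b * vB) := by positivity
  nlinarith

noncomputable def ew (X : Finset (Finset V)) (t : ℕ) (τ : Finset V) (u v : V) : ℝ :=
  if u ≠ v ∧ u ∉ τ ∧ v ∉ τ then w X t (insert v (insert u τ)) else 0

lemma ew_deg (X : Finset (Finset V)) (t : ℕ) (τ : Finset V) (u : V) :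
    ∑ v, ew X t τ u v = if u ∉ τ then w X t (insert u τ) * ((t - τ.card - 1 : ℕ) : ℝ) else 0 := by
  unfold ew
  by_cases hu : u ∉ τ
  · rw [if_pos hu]
    have := sum_ext1 X t (insert u τ)
    rw [card_insert_of_notMem hu, sum_filter] at this
    rw [Nat.sub_sub, ← this]
    refine sum_congr rfl fun v _ => ?_
    congr 1
    simp only [mem_insert, not_or, eq_iff_iff]
    constructor
    · rintro ⟨h1, h2, h3⟩; exact ⟨fun e => h1 e.symm, h3⟩
    · rintro ⟨h1, h2⟩; exact ⟨fun e => h1 e.symm, hu, h2⟩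
  · rw [if_neg hu]
    refine sum_eq_zero fun v _ => ?_
    simp at hu
    simp [hu]

lemma ew_vol (X : Finset (Finset V)) (t : ℕ) (τ : Finset V) :
    ∑ u, ∑ v, ew X t τ u v = w X t τ * ((t - τ.card : ℕ) : ℝ) * ((t - τ.card - 1 : ℕ) : ℝ) := by
  simp_rw [ew_deg]
  rw [← sum_filter, ← sum_mul, sum_ext1]

lemma edgeWt_eq (X : Finset (Finset V)) (t : ℕ) (τ : Finset V) (hτ : τ.card ≤ t) (u v : V) :
    edgeWt (link X τ) (t - τ.card) u v =
      (w X t τ * ((t - τ.card).choose 2 : ℝ))⁻¹ * ew X t τ u v := by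
  unfold edgeWt ew
  by_cases huv : u = v
  · simp [huv]
  · rw [if_pos huv, wt_eq _ _ _ _ (by simp [card_pair huv])]
    rw [w_link _ _ _ _ hτ (disjoint_empty_left _), empty_union, sum_singleton, div_eq_inv_mul]
    congr 1
    by_cases hd : Disjoint ({u, v} : Finset V) τ
    · rw [w_link _ _ _ _ hτ hd]
      simp only [disjoint_insert_left, disjoint_singleton_left] at hd
      rw [if_pos ⟨huv, hd⟩]
      congr 1
      ext x; simp; tauto
    · rw [w_link_zero _ _ _ _ hd]
      simp only [disjoint_insert_left, disjoint_singleton_left] at hd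
      rw [if_neg (fun h => hd h.2)]

lemma mixing {X : Finset (Finset V)} {d : ℕ} (hXd : IsPureDim X d) {lam : ℝ} (hlam : 0 ≤ lam)
    (hlse : IsLocalSpectralExpander X d lam) {τ : Finset V} (hτ : τ ∈ X) (hτc : τ.card + 2 ≤ d + 1)
    (B : Finset V) (hB : ∀ u ∈ B, u ∉ τ) (θ : ℝ)
    (hθ : ∑ u ∈ B, w X (d+1) (insert u τ) ≤ θ * (w X (d+1) τ * ((d + 1 - τ.card : ℕ) : ℝ))) :
    ∑ u ∈ B, ∑ v ∈ B, ew X (d+1) τ u v ≤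
      (θ + lam) * ((d + 1 - τ.card - 1 : ℕ) : ℝ) * ∑ u ∈ B, w X (d+1) (insert u τ) := by
  have hK : 0 < w X (d+1) τ := w_pos hXd hτ
  have hK2 : (0 : ℝ) < ((d + 1 - τ.card).choose 2 : ℝ) := by
    exact_mod_cast Nat.choose_pos (by omega)
  have hn1 : (0 : ℝ) < ((d + 1 - τ.card : ℕ) : ℝ) := by norm_cast; omega
  have hn2 : (0 : ℝ) < ((d + 1 - τ.card - 1 : ℕ) : ℝ) := by norm_cast; omega
  have hexp : IsSpectralExpanderW (ew X (d+1) τ) lam := by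
    have h := hlse τ hτ hτc
    intro f hf
    have hf' := h f
    simp_rw [edgeWt_eq X (d+1) τ (by omega)] at hf'
    set K := (w X (d+1) τ * ((d + 1 - τ.card).choose 2 : ℝ))⁻¹ with hKd
    have hKp : 0 < K := by positivity
    simp_rw [mul_assoc, ← mul_sum, mul_assoc, ← mul_sum] at hf'
    simp_rw [mul_assoc]
    have := hf' (by rw [hf, mul_zero])
    rw [abs_mul, abs_of_pos hKp, mul_left_comm] at this
    exact le_of_mul_le_mul_left this hKp
  have hdeg : ∑ u ∈ B, ∑ v, ew X (d+1) τ u v =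
      ((d + 1 - τ.card - 1 : ℕ) : ℝ) * ∑ u ∈ B, w X (d+1) (insert u τ) := by
    rw [mul_sum]
    refine sum_congr rfl fun u hu => ?_
    rw [ew_deg, if_pos (hB u hu), mul_comm]
  have hm := mix_generic (ew X (d+1) τ) lam hlam
    (by
      intro u v
      unfold ew
      have e : insert v (insert u τ) = insert u (insert v τ) := Finset.insert_comm _ _ _
      rw [e]
      congr 1
      simp only [eq_iff_iff]
      constructor
      · rintro ⟨h1, h2, h3⟩; exact ⟨h1.symm, h3, h2⟩
      · rintro ⟨h1, h2, h3⟩; exact ⟨h1.symm, h3, h2⟩)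
    (by
      intro u v
      unfold ew
      split_ifs
      · exact w_nonneg _ _ _
      · exact le_refl _) hexp B _ rfl (by rw [ew_vol]; positivity)
  refine hm.trans ?_
  rw [ew_vol, hdeg]
  set P := ∑ u ∈ B, w X (d+1) (insert u τ)
  have hP : 0 ≤ P := sum_nonneg fun _ _ => w_nonneg _ _ _
  rw [mul_comm (θ + lam), mul_assoc, mul_assoc ((d + 1 - τ.card - 1 : ℕ) : ℝ), mul_comm (θ + lam)]
  refine mul_le_mul_of_nonneg_left ?_ hn2.le
  refine mul_le_mul_of_nonneg_left ?_ hP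
  refine add_le_add ?_ (le_refl _)
  rw [div_le_iff₀ (by positivity)]
  nlinarith

variable {X : Finset (Finset V)} {t c : ℕ} {A : Finset (Finset V)} {η : ℝ}

noncomputable def Bt (X : Finset (Finset V)) (t c : ℕ) (A : Finset (Finset V)) (η : ℝ) (r : ℕ)
    (τ : Finset V) : Finset V :=
  univ.filter fun u => u ∉ τ ∧ insert u τ ∈ S X t c A η r

lemma Bt_sum (hA : A ⊆ facesCard X c) (r : ℕ) (τ : Finset V) (hτ : τ.card + 1 = c - r) :
    ∑ u ∈ Bt X t c A η r τ, w X t (insert u τ) =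
      ∑ s ∈ (S X t c A η r).filter (fun s => τ ⊆ s), w X t s := by
  refine Finset.sum_bij (fun v _ => insert v τ) ?_ ?_ ?_ (fun _ _ => rfl)
  · intro v hv
    simp only [Bt, mem_filter, mem_univ, true_and] at hv ⊢
    exact ⟨hv.2, subset_insert _ _⟩
  · intro v hv v' hv' e
    simp only [Bt, mem_filter, mem_univ, true_and] at hv hv'
    exact (insert_inj hv.1).1 e
  · intro ρ hρ
    simp only [mem_filter] at hρ
    have := S_card hA hρ.1
    obtain ⟨v, hv, rfl⟩ := (covBy_iff_exists_insert.1
      (covBy_iff_card_sdiff_eq_one.2 ⟨hρ.2, by rw [card_sdiff_of_subset hρ.2]; omega⟩))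
    exact ⟨v, by simp [Bt, hv, hρ.1], rfl⟩

noncomputable def PP (X : Finset (Finset V)) (t c : ℕ) (A : Finset (Finset V)) (η : ℝ) (r : ℕ) :
    Finset (Finset V) :=
  univ.filter fun p => p.card = c - r + 1 ∧ ∃ σ ∈ S X t c A η r, ∃ σ' ∈ S X t c A η r,
    σ ≠ σ' ∧ p = σ ∪ σ' ∧ σ ∩ σ' ∉ S X t c A η (r + 1)

noncomputable def Ups (X : Finset (Finset V)) (t c : ℕ) (A : Finset (Finset V)) (η : ℝ) :
    Finset (Finset V) :=
  (facesCard X (c + 1)).filter fun ρ => ¬ Good X t c A η ρ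

lemma W_PP_triple (hX : IsComplex X) (hA : A ⊆ facesCard X c) (r : ℕ) (hr : r < c) :
    W X t (PP X t c A η r) ≤ ∑ τ ∈ facesCard X (c - (r + 1)) \ S X t c A η (r + 1),
      ∑ u ∈ Bt X t c A η r τ, ∑ v ∈ Bt X t c A η r τ, ew X t τ u v := by
  have key : ∀ p ∈ PP X t c A η r, ∃ τ ∈ facesCard X (c - (r + 1)) \ S X t c A η (r + 1),
      ∃ u ∈ Bt X t c A η r τ, ∃ v ∈ Bt X t c A η r τ, u ≠ v ∧ p = insert v (insert u τ) := by
    intro p hp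
    simp only [PP, mem_filter, mem_univ, true_and] at hp
    obtain ⟨hpc, σ, hσ, σ', hσ', hne, rfl, hint⟩ := hp
    have h1 := S_card hA hσ
    have h2 := S_card hA hσ'
    have h3 := card_union_add_card_inter σ σ'
    have h4 : (σ ∩ σ').card + 1 = σ.card := by omega
    have h5 : (σ ∩ σ').card + 1 = σ'.card := by omega
    obtain ⟨u, hu, hu'⟩ := (covBy_iff_exists_insert.1
      (covBy_iff_card_sdiff_eq_one.2 ⟨inter_subset_left, by
        rw [card_sdiff_of_subset (inter_subset_left (s₁ := σ) (s₂ := σ'))]; omega⟩))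
    obtain ⟨v, hv, hv'⟩ := (covBy_iff_exists_insert.1
      (covBy_iff_card_sdiff_eq_one.2 ⟨inter_subset_right, by
        rw [card_sdiff_of_subset (inter_subset_right (s₁ := σ) (s₂ := σ'))]; omega⟩))
    refine ⟨σ ∩ σ', ?_, u, ?_, v, ?_, ?_, ?_⟩
    · rw [mem_sdiff, mem_facesCard]
      exact ⟨⟨hX σ (S_mem hA hσ) _ inter_subset_left, by omega⟩, hint⟩
    · simp only [Bt, mem_filter, mem_univ, true_and]; exact ⟨hu, by rw [hu']; exact hσ⟩
    · simp only [Bt, mem_filter, mem_univ, true_and]; exact ⟨hv, by rw [hv']; exact hσ'⟩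
    · rintro rfl; exact hne (hu'.symm.trans hv')
    · rw [hu']
      ext x
      have := Finset.ext_iff.1 hv' x
      simp only [mem_insert, mem_inter, mem_union] at this ⊢
      tauto
  have hew : ∀ τ u v, 0 ≤ ew X t τ u v := by
    intro τ u v
    unfold ew
    split_ifs
    · exact w_nonneg _ _ _
    · exact le_refl _
  have hif : ∀ (p : Finset V) τ u v,
      0 ≤ if p = insert v (insert u τ) then ew X t τ u v else 0 := by
    intro p τ u v
    split_ifs
    · exact hew _ _ _
    · exact le_refl _
  calc W X t (PP X t c A η r) ≤ ∑ p ∈ PP X t c A η r,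
        ∑ τ ∈ facesCard X (c - (r + 1)) \ S X t c A η (r + 1),
        ∑ u ∈ Bt X t c A η r τ, ∑ v ∈ Bt X t c A η r τ,
          if p = insert v (insert u τ) then ew X t τ u v else 0 := by
        refine sum_le_sum fun p hp => ?_
        obtain ⟨τ, hτ, u, hu, v, hv, huv, hpe⟩ := key p hp
        refine le_trans ?_ (single_le_sum (f := fun τ => ∑ u ∈ Bt X t c A η r τ,
          ∑ v ∈ Bt X t c A η r τ, if p = insert v (insert u τ) then ew X t τ u v else 0)
          (fun τ _ => sum_nonneg fun u _ => sum_nonneg fun v _ => hif p τ u v) hτ)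
        refine le_trans ?_ (single_le_sum (f := fun u =>
          ∑ v ∈ Bt X t c A η r τ, if p = insert v (insert u τ) then ew X t τ u v else 0)
          (fun u _ => sum_nonneg fun v _ => hif p τ u v) hu)
        refine le_trans ?_ (single_le_sum (f := fun v =>
          if p = insert v (insert u τ) then ew X t τ u v else 0)
          (fun v _ => hif p τ u v) hv)
        rw [if_pos hpe]
        simp only [Bt, mem_filter, mem_univ, true_and] at hu hv
        rw [ew, if_pos ⟨huv, hu.1, hv.1⟩, hpe]
    _ ≤ _ := by
        rw [sum_comm]
        refine sum_le_sum fun τ _ => ?_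
        rw [sum_comm]
        refine sum_le_sum fun u _ => ?_
        rw [sum_comm]
        refine sum_le_sum fun v _ => ?_
        rw [sum_ite_eq']
        split_ifs
        · exact le_refl _
        · exact hew _ _ _

lemma W_PP {d : ℕ} (hXd : IsPureDim X d) {lam : ℝ} (hlam : 0 ≤ lam)
    (hlse : IsLocalSpectralExpander X d lam)
    (hX : IsComplex X) (hA : A ⊆ facesCard X c) (hc : c ≤ d) (r : ℕ) (hr : r < c)
    (hle : lam ≤ η ^ 2 ^ r) (hη : 0 < η) :
    W X (d+1) (PP X (d+1) c A η r) ≤ 2 * η ^ 2 ^ r * ((d + 1 - (c - r) : ℕ) : ℝ) *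
      (((c - r : ℕ) : ℝ) * W X (d+1) (S X (d+1) c A η r)) := by
  refine (W_PP_triple hX hA r hr).trans ?_
  have e : (c - r).choose (c - (r + 1)) = c - r := by
    have : c - r = (c - (r+1)) + 1 := by omega
    rw [this, Nat.choose_succ_self_right]
  have h := sum_sub_le (X := X) (t := d + 1) (S X (d+1) c A η r)
    (facesCard X (c - (r + 1)) \ S X (d+1) c A η (r + 1)) (c - r) (c - (r + 1))
    (fun s hs => S_card hA hs) (fun s hs => (mem_facesCard.1 (mem_sdiff.1 hs).1).2)
  rw [e] at h
  refine le_trans ?_ (mul_le_mul_of_nonneg_left h (by positivity))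
  rw [mul_sum]
  refine sum_le_sum fun τ hτ => ?_
  have hτ' := mem_sdiff.1 hτ
  have hτ1 := mem_facesCard.1 hτ'.1
  have hb := Bt_sum (t := d + 1) (η := η) hA r τ (by omega)
  rw [← hb]
  have hn : ¬ (η ^ 2 ^ r * (w X (d+1) τ * ((d + 1 - (c - (r + 1)) : ℕ) : ℝ)) <
        ∑ s ∈ (S X (d+1) c A η r).filter (fun s => τ ⊆ s), w X (d+1) s) := fun hlt =>
    hτ'.2 (mem_filter.2 ⟨hτ'.1, hlt⟩)
  have hm := mixing hXd hlam hlse hτ1.1 (by omega) (Bt X (d+1) c A η r τ)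
    (fun u hu => (by simp only [Bt, mem_filter, mem_univ, true_and] at hu; exact hu.1))
    (η ^ 2 ^ r) (by rw [hb, hτ1.2]; exact not_lt.1 hn)
  refine hm.trans ?_
  have hs : d + 1 - τ.card - 1 = d + 1 - (c - r) := by omega
  rw [hs]
  refine mul_le_mul_of_nonneg_right ?_ (sum_nonneg fun _ _ => w_nonneg _ _ _)
  refine mul_le_mul_of_nonneg_right ?_ (by positivity)
  linarith

lemma W_Ups (hX : IsComplex X) (hA : A ⊆ facesCard X c) :
    W X t (Ups X t c A η) ≤ ∑ r ∈ range c,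
      ((t - (c - r + 1)).choose r : ℝ) * W X t (PP X t c A η r) := by
  have key : ∀ ρ ∈ Ups X t c A η, ∃ r ∈ range c, ∃ p ∈ PP X t c A η r, p ⊆ ρ := by
    intro ρ hρ
    rw [Ups, mem_filter] at hρ
    obtain ⟨h1, h2⟩ := hρ
    unfold Good at h2
    push Not at h2
    obtain ⟨r, hr, σ, hσ, σ', hσ', h3, h4, h5, h6, h7⟩ := h2
    refine ⟨r, mem_range.2 hr, σ ∪ σ', ?_, union_subset h3 h4⟩
    simp only [PP, mem_filter, mem_univ, true_and]
    exact ⟨h6, σ, hσ, σ', hσ', h5, rfl, h7⟩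
  have hif : ∀ p ρ : Finset V, 0 ≤ if p ⊆ ρ then w X t ρ else 0 := by
    intro p ρ
    split_ifs
    · exact w_nonneg _ _ _
    · exact le_refl _
  calc W X t (Ups X t c A η) ≤ ∑ ρ ∈ Ups X t c A η, ∑ r ∈ range c, ∑ p ∈ PP X t c A η r,
        if p ⊆ ρ then w X t ρ else 0 := by
        refine sum_le_sum fun ρ hρ => ?_
        obtain ⟨r, hr, p, hp, hpρ⟩ := key ρ hρ
        refine le_trans ?_ (single_le_sum (f := fun r => ∑ p ∈ PP X t c A η r,
          if p ⊆ ρ then w X t ρ else 0)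
          (fun r _ => sum_nonneg fun p _ => hif p ρ) hr)
        refine le_trans ?_ (single_le_sum (f := fun p => if p ⊆ ρ then w X t ρ else 0)
          (fun p _ => hif p ρ) hp)
        rw [if_pos hpρ]
    _ ≤ _ := by
        rw [sum_comm]
        refine sum_le_sum fun r hr => ?_
        rw [mem_range] at hr
        rw [sum_comm, W, mul_sum]
        refine sum_le_sum fun p hp => ?_
        simp only [PP, mem_filter, mem_univ, true_and] at hp
        have := sum_ext X t (c + 1) p (by omega)
        rw [hp.1, show c + 1 - (c - r + 1) = r by omega] at this
        rw [mul_comm, ← this, ← sum_filter]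
        refine sum_le_sum_of_subset_of_nonneg ?_ (fun _ _ _ => w_nonneg _ _ _)
        intro ρ hρ
        simp only [Ups, mem_filter, mem_facesCard, mem_univ, true_and] at hρ ⊢
        exact ⟨hρ.2, hρ.1.1.2⟩

/-- the bad faces are rare -/
lemma Ups_bound {d : ℕ} (hXd : IsPureDim X d) {lam : ℝ} (hlam : 0 ≤ lam)
    (hlse : IsLocalSpectralExpander X d lam)
    (hX : IsComplex X) (hA : A ⊆ facesCard X c) (hc : c ≤ d) 
    (hle : ∀ r < c, lam ≤ η ^ 2 ^ r) (hη : 0 < η) :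
    ((c : ℝ) + 1) * W X (d+1) (Ups X (d+1) c A η) ≤
      ((d + 1 - c : ℕ) : ℝ) * (2 ^ c * c * (c + 1) * η * W X (d+1) A) := by
  have hterm : ∀ r ∈ range c, ((c : ℝ) + 1) * (((d + 1 - (c - r + 1)).choose r : ℝ) *
      W X (d+1) (PP X (d+1) c A η r)) ≤
      ((d + 1 - c : ℕ) : ℝ) * (2 * η * W X (d+1) A * (c * (c + 1))) * ((c - 1).choose r : ℝ) := by
    intro r hr
    rw [mem_range] at hr
    have h1 := W_PP hXd hlam hlse hX hA hc r hr (hle r hr) hη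
    have h2 := W_bound (X := X) (t := d + 1) (η := η) hA hη (by omega) r hr.le
    have hcc : (0 : ℝ) < ((d + 1).choose c : ℝ) := by exact_mod_cast Nat.choose_pos (by omega)
    refine le_of_mul_le_mul_right ?_ hcc
    obtain ⟨j, rfl⟩ : ∃ j, c = r + 1 + j := ⟨c - r - 1, by omega⟩
    rw [show r + 1 + j - r = j + 1 by omega] at *
    rw [show r + 1 + j - 1 = r + j by omega] at *
    have hpow : η ^ 2 ^ r = η * η ^ (2 ^ r - 1) := by
      rw [← pow_succ', Nat.sub_add_cancel Nat.one_le_two_pow]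
    -- binomial identities
    have i1 : ((d + 1).choose (j + 1) : ℝ) * ((d + 1 - (j + 1) : ℕ) : ℝ) =
        (d + 1).choose (j + 2) * (j + 2) := by
      have := Nat.choose_succ_right_eq (d + 1) (j + 1)
      have h : ((d + 1).choose (j + 2) : ℝ) * ((j + 2 : ℕ) : ℝ) = (d + 1).choose (j + 1)
        * ((d + 1 - (j + 1) : ℕ) : ℝ) := by exact_mod_cast this
      rw [← h]; push_cast; ring
    have i2 : ((d + 1).choose (j + 2) : ℝ) * ((d + 1 - (j + 2)).choose r : ℝ) =
        (d + 1).choose (r + j + 2) * (r + j + 2).choose (j + 2) := by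
      have := Nat.choose_mul (n := d + 1) (k := r + j + 2) (s := j + 2)  (by omega)
      rw [show r + j + 2 - (j + 2) = r by omega] at this
      exact_mod_cast this.symm
    have i3 : ((d + 1).choose (r + j + 2) : ℝ) * (r + j + 2) =
        (d + 1).choose (r + 1 + j) * ((d + 1 - (r + 1 + j) : ℕ) : ℝ) := by
      have := Nat.choose_succ_right_eq (d + 1) (r + 1 + j)
      rw [show r + 1 + j + 1 = r + j + 2 by omega] at this
      exact_mod_cast this
    have i4 : ((r + j + 2).choose (j + 2) : ℝ) * ((j + 2) * (j + 1)) =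
        (r + 1 + j) * (r + 1 + j + 1) * (r + j).choose r := by
      have a1 := Nat.add_one_mul_choose_eq (r + j + 1) (j + 1)
      have a2 := Nat.add_one_mul_choose_eq (r + j) j
      have a3 : (r + j).choose j = (r + j).choose r := (Nat.choose_symm_add).symm
      rw [a3] at a2
      have b1 : ((r : ℝ) + j + 1 + 1) * (r + j + 1).choose (j + 1) =
        (r + j + 2).choose (j + 2) * (j + 1 + 1) := by exact_mod_cast a1
      have b2 : ((r : ℝ) + j + 1) * (r + j).choose r =
        (r + j + 1).choose (j + 1) * (j + 1) := by exact_mod_cast a2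
      linear_combination (-(j:ℝ) - 1) * b1 - (r + j + 2) * b2
    rw [hpow] at h1
    simp only [Nat.cast_add, Nat.cast_one] at h1 h2 ⊢
    set P := W X (d+1) (PP X (d+1) (r + 1 + j) A η r)
    set Q := W X (d+1) (S X (d+1) (r + 1 + j) A η r)
    set Z := W X (d+1) A
    set a := ((d + 1).choose (j + 1) : ℝ)
    set b := ((d + 1).choose (j + 2) : ℝ)
    set e := ((d + 1).choose (r + j + 2) : ℝ)
    set C := ((d + 1).choose (r + 1 + j) : ℝ)
    set D := ((d + 1 - (j + 1 + 1)).choose r : ℝ)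
    set n := ((d + 1 - (j + 1) : ℕ) : ℝ)
    set n' := ((d + 1 - (r + 1 + j) : ℕ) : ℝ)
    set κ := η ^ (2 ^ r - 1)
    have hn : 0 ≤ n := Nat.cast_nonneg _
    have hD : 0 ≤ D := Nat.cast_nonneg _
    have hC : 0 ≤ C := Nat.cast_nonneg _
    have k1 : P * C ≤ 2 * η * n * (j + 1) * (a * Z) := by
      calc P * C ≤ (2 * (η * κ) * n * ((j + 1) * Q)) * C := mul_le_mul_of_nonneg_right h1 hC
        _ = 2 * η * n * (j + 1) * (κ * Q * C) := by ring
        _ ≤ _ := mul_le_mul_of_nonneg_left h2 (by positivity)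
    calc (((r : ℝ) + 1 + j + 1) * (D * P)) * C = ((r : ℝ) + 1 + j + 1) * D * (P * C) := by ring
      _ ≤ ((r : ℝ) + 1 + j + 1) * D * (2 * η * n * (j + 1) * (a * Z)) :=
          mul_le_mul_of_nonneg_left k1 (by positivity)
      _ = _ := by
        linear_combination (((r : ℝ) + 1 + j + 1) * D * 2 * η * (j + 1) * Z) * i1 +
          (((r : ℝ) + 1 + j + 1) * 2 * η * (j + 1) * Z * (j + 2)) * i2 +
          (2 * η * (j + 1) * Z * (j + 2) * (r + j + 2).choose (j + 2)) * i3
          + (2 * η * Z * C * n') * i4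
  have h := W_Ups (t := d + 1) (η := η) hX hA
  have hc1 : (0 : ℝ) ≤ (c : ℝ) + 1 := by positivity
  refine (mul_le_mul_of_nonneg_left h hc1).trans ?_
  rw [mul_sum]
  refine (sum_le_sum hterm).trans ?_
  rw [← mul_sum]
  rcases Nat.eq_zero_or_pos c with h0 | h0
  · subst h0; simp
  · obtain ⟨c', rfl⟩ : ∃ c', c = c' + 1 := ⟨c - 1, by omega⟩
    have hs : ∑ r ∈ range (c' + 1), ((c' + 1 - 1).choose r : ℝ) = 2 ^ c' := by
      rw [Nat.add_sub_cancel]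
      exact_mod_cast Nat.sum_range_choose c'
    rw [hs]
    refine le_of_eq ?_
    rw [pow_succ]; push_cast; ring

end HDXP

namespace HDXP
open HDX
variable {V : Type*} [Fintype V] [DecidableEq V] {G : Type*} [AddCommGroup G]

def Anti {m : ℕ} (f : (Fin m → V) → G) : Prop :=
  ∀ (tup : Fin m → V) (π : Equiv.Perm (Fin m)),
      f (tup ∘ π) = ((Equiv.Perm.sign π : ℤˣ) : ℤ) • f tup

lemma perm_succAbove {n : ℕ} (π : Equiv.Perm (Fin (n + 1))) (j : Fin (n + 1)) :
    ∃ π' : Equiv.Perm (Fin n), (⇑π ∘ j.succAbove = (π j).succAbove ∘ π') ∧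
      Equiv.Perm.sign π' = (-1) ^ (π j : ℕ) * Equiv.Perm.sign π * (-1) ^ (j : ℕ) := by
  set Q : Equiv.Perm (Fin (n+1)) := (π j).cycleRange * π * j.cycleRange.symm with hQ
  have hQ0 : Q 0 = 0 := by simp [hQ]
  obtain ⟨⟨p, π'⟩, hpe⟩ := Equiv.Perm.decomposeFin.symm.surjective Q
  have hp : p = 0 := by
    rw [← hQ0, ← hpe]; simp
  subst hp
  refine ⟨π', ?_, ?_⟩
  · funext x
    have h1 : Q x.succ = (π' x).succ := by
      rw [← hpe, Equiv.Perm.decomposeFin_symm_apply_succ]; simp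
    have h2 : Q x.succ = (π j).cycleRange (π (j.succAbove x)) := by
      simp [hQ]
    rw [h1] at h2
    have h3 := congrArg (π j).cycleRange.symm h2
    simp at h3
    simp [h3]
  · have h1 : Equiv.Perm.sign Q = Equiv.Perm.sign π' := by
      rw [← hpe, Equiv.Perm.decomposeFin.symm_sign]; simp
    rw [← h1, hQ]
    simp [Equiv.Perm.sign_symm]

lemma anti_sum {m : ℕ} (φ : V → (Fin m → V) → G) (hφ : ∀ v, Anti (φ v)) :
    Anti (fun tup : Fin (m + 1) → V =>
      ∑ i : Fin (m + 1), ((-1 : ℤ) ^ (i : ℕ)) • φ (tup i) (tup ∘ i.succAbove)) := by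
  intro tup π
  simp only []
  rw [smul_sum, ← Equiv.sum_comp π (fun i => ((Equiv.Perm.sign π : ℤˣ) : ℤ) • ((-1 : ℤ) ^ (i : ℕ)) • φ (tup i) (tup ∘ i.succAbove))]
  refine sum_congr rfl fun j _ => ?_
  obtain ⟨π', h1, h2⟩ := perm_succAbove π j
  rw [Function.comp_assoc, h1, ← Function.comp_assoc, hφ, h2, smul_smul, smul_smul]
  congr 1
  push_cast
  have : ((-1 : ℤ) ^ (j : ℕ)) * ((-1 : ℤ) ^ (j : ℕ)) = 1 := by
    rw [← mul_pow]; simp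
  linear_combination ((-1 : ℤ) ^ (π j : ℕ) * (Equiv.Perm.sign π : ℤ)) * this

lemma anti_cob {m : ℕ} {f : (Fin m → V) → G} (hf : Anti f) : Anti (cob f) :=
  anti_sum (fun _ => f) (fun _ => hf)

lemma anti_sub {m : ℕ} {f g : (Fin m → V) → G} (hf : Anti f) (hg : Anti g) :
    Anti (fun t => f t - g t) := by
  intro tup π
  simp only [hf tup π, hg tup π, smul_sub]

lemma anti_localize {m : ℕ} {f : (Fin (m + 1) → V) → G} (hf : Anti f) (v : V) :
    Anti (localizeC f v) := by
  intro tup π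
  unfold localizeC
  have := hf (Fin.cons v tup) (Equiv.Perm.decomposeFin.symm (0, π))
  rw [Equiv.Perm.decomposeFin.symm_sign] at this
  simp only [if_true, one_mul] at this
  rw [← this]
  congr 1
  funext x
  refine Fin.cases ?_ (fun y => ?_) x
  · simp
  · simp

lemma cob_cons {m : ℕ} (f : (Fin (m + 1) → V) → G) (v : V) (b : Fin (m + 1) → V) :
    cob f (Fin.cons v b) = f b - cob (localizeC f v) b := by
  unfold cob localizeC
  rw [Fin.sum_univ_succ]
  have h0 : (Fin.cons v b : Fin (m+2) → V) ∘ (0 : Fin (m + 2)).succAbove = b := by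
    funext x; simp
  rw [h0]
  simp only [Fin.val_zero, pow_zero, one_smul, sub_eq_add_neg, ← sum_neg_distrib]
  congr 1
  refine sum_congr rfl fun i _ => ?_
  have : (Fin.cons v b : Fin (m+2) → V) ∘ i.succ.succAbove = Fin.cons v (b ∘ i.succAbove) := by
    funext x
    refine Fin.cases ?_ (fun y => ?_) x
    · simp
    · simp
  rw [this, Fin.val_succ, pow_succ]
  simp

lemma exists_perm {m : ℕ} {a b : Fin m → V} (ha : Function.Injective a)
    (h : image a univ = image b univ) : ∃ π : Equiv.Perm (Fin m), b = a ∘ π := by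
  have hb : Function.Injective b := by
    have h1 : (image b univ).card = (univ : Finset (Fin m)).card := by
      rw [← h, card_image_of_injective _ ha]
    have := card_image_iff.1 h1
    simpa using this
  have h2 : ∀ i, ∃ j, a j = b i := by
    intro i
    have : b i ∈ image a univ := by rw [h]; exact mem_image_of_mem _ (mem_univ _)
    simpa using this
  choose p hp using h2
  have hpi : Function.Injective p := by
    intro x y hxy
    apply hb; rw [← hp, ← hp, hxy]
  refine ⟨Equiv.ofBijective p (Finite.injective_iff_bijective.1 hpi), ?_⟩
  funext i
  simp [hp]

lemma anti_ne {m : ℕ} {f : (Fin m → V) → G} (hf : Anti f) (tup : Fin m → V)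
    (π : Equiv.Perm (Fin m)) : f (tup ∘ π) ≠ 0 ↔ f tup ≠ 0 := by
  rw [hf]
  rcases Int.units_eq_one_or (Equiv.Perm.sign π) with h | h <;> simp [h]

lemma anti_iff {m : ℕ} {f : (Fin m → V) → G} (hf : Anti f) {a b : Fin m → V}
    (ha : Function.Injective a) (h : image a univ = image b univ) :
    f b ≠ 0 ↔ f a ≠ 0 := by
  obtain ⟨π, rfl⟩ := exists_perm ha h
  exact anti_ne hf a π

lemma exists_tup {m : ℕ} {s : Finset V} (h : s.card = m) :
    ∃ a : Fin m → V, Function.Injective a ∧ image a univ = s := by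
  let e := (s.equivFinOfCardEq h).symm
  refine ⟨fun i => (e i : V), fun x y hxy => e.injective (Subtype.ext hxy), ?_⟩
  ext v
  simp only [mem_image, mem_univ, true_and]
  constructor
  · rintro ⟨i, rfl⟩; exact (e i).2
  · intro hv; exact ⟨e.symm ⟨v, hv⟩, by simp⟩

lemma mem_suppC {Y : Finset (Finset V)} {m : ℕ} {f : (Fin m → V) → G} (hf : Anti f)
    {a : Fin m → V} (ha : Function.Injective a) :
    image a univ ∈ suppC Y f ↔ image a univ ∈ Y ∧ f a ≠ 0 := by
  unfold suppC
  rw [mem_filter, mem_facesCard]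
  constructor
  · rintro ⟨⟨h1, h2⟩, b, h3, h4⟩
    exact ⟨h1, (anti_iff hf ha h3.symm).1 h4⟩
  · rintro ⟨h1, h2⟩
    refine ⟨⟨h1, ?_⟩, a, rfl, h2⟩
    rw [card_image_of_injective _ ha]; simp

lemma suppC_sub {Y : Finset (Finset V)} {m : ℕ} (f : (Fin m → V) → G) :
    suppC Y f ⊆ facesCard Y m := filter_subset _ _

lemma normC_eq (Y : Finset (Finset V)) (t : ℕ) {m : ℕ} (f : (Fin m → V) → G) :
    normC Y t f = (∑ s ∈ suppC Y f, w Y t s) / (w Y t ∅ * (t.choose m : ℝ)) := by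
  unfold normC
  exact wt_eq Y t m _ fun s hs => (mem_facesCard.1 (suppC_sub _ hs)).2

lemma supp_link_sum (Y : Finset (Finset V)) (t : ℕ) (σ : Finset V) (hσ : σ.card ≤ t) {q : ℕ}
    (H : (Fin q → V) → G) :
    ∑ s ∈ suppC (link Y σ) H, w (link Y σ) (t - σ.card) s =
    ∑ s ∈ (facesCard Y (q + σ.card)).filter
      (fun s => σ ⊆ s ∧ ∃ tup : Fin q → V, image tup univ = s \ σ ∧ H tup ≠ 0), w Y t s := by
  refine sum_bij' (fun s _ => s ∪ σ) (fun s _ => s \ σ) ?_ ?_ ?_ ?_ ?_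
  · intro s hs
    unfold suppC at hs
    rw [mem_filter, mem_facesCard, mem_link] at hs
    obtain ⟨⟨⟨h1, h2⟩, h3⟩, tup, h4, h5⟩ := hs
    rw [mem_filter, mem_facesCard]
    refine ⟨⟨h2, ?_⟩, subset_union_right, tup, ?_, h5⟩
    · rw [card_union_of_disjoint h1, h3]
    · rw [union_sdiff_cancel_right h1, h4]
  · intro s hs
    rw [mem_filter, mem_facesCard] at hs
    obtain ⟨⟨h1, h2⟩, h3, h4⟩ := hs
    unfold suppC
    rw [mem_filter, mem_facesCard, mem_link]
    refine ⟨⟨⟨sdiff_disjoint, ?_⟩, ?_⟩, h4⟩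
    · rw [sdiff_union_of_subset h3]; exact h1
    · rw [card_sdiff_of_subset h3, h2]; omega
  · intro s hs
    unfold suppC at hs
    rw [mem_filter, mem_facesCard, mem_link] at hs
    exact union_sdiff_cancel_right hs.1.1.1
  · intro s hs
    rw [mem_filter] at hs
    exact sdiff_union_of_subset hs.2.1
  · intro s hs
    unfold suppC at hs
    rw [mem_filter, mem_facesCard, mem_link] at hs
    exact w_link Y t σ s hσ hs.1.1.1

lemma link_link (Y : Finset (Finset V)) (σ : Finset V) (v : V) (hv : v ∉ σ) :
    link (link Y σ) {v} = link Y (insert v σ) := by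
  ext s
  simp only [mem_link]
  constructor
  · rintro ⟨h1, h2, h3⟩
    rw [disjoint_union_left] at h2
    refine ⟨?_, ?_⟩
    · rw [disjoint_insert_right]; exact ⟨by simpa using h1, h2.1⟩
    · convert h3 using 1; ext; simp
  · rintro ⟨h1, h2⟩
    rw [disjoint_insert_right] at h1
    refine ⟨by simpa using h1.1, ?_, ?_⟩
    · rw [disjoint_union_left]; exact ⟨h1.2, by simpa using hv⟩
    · convert h2 using 1; ext; simp

def lift (v : V) {q : ℕ} (h : (Fin q → V) → G) : (Fin (q + 1) → V) → G := fun tup =>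
  ∑ i : Fin (q + 1), ((-1 : ℤ) ^ (i : ℕ)) • (if tup i = v then h (tup ∘ i.succAbove) else 0)

lemma anti_lift (v : V) {q : ℕ} {h : (Fin q → V) → G} (hh : Anti h) : Anti (lift v h) := by
  have := anti_sum (fun u => fun b => if u = v then h b else 0) (fun u => by
    intro tup π
    by_cases hu : u = v
    · simp only [hu, if_true]; exact hh tup π
    · simp [hu])
  exact this

lemma image_succAbove {q : ℕ} (a : Fin (q + 1) → V) (i : Fin (q + 1)) :
    image a univ = insert (a i) (image (a ∘ i.succAbove) univ) := by
  ext x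
  simp only [mem_image, mem_univ, true_and, mem_insert, Function.comp]
  constructor
  · rintro ⟨j, rfl⟩
    rcases Fin.eq_self_or_eq_succAbove i j with h | ⟨k, h⟩
    · left; rw [h]
    · right; exact ⟨k, by rw [h]⟩
  · rintro (rfl | ⟨k, rfl⟩)
    · exact ⟨_, rfl⟩
    · exact ⟨_, rfl⟩

lemma image_cons {q : ℕ} (v : V) (b : Fin q → V) :
    image (Fin.cons v b : Fin (q + 1) → V) univ = insert v (image b univ) := by
  rw [image_succAbove _ 0]
  congr 1

lemma inj_cons {q : ℕ} (v : V) (b : Fin q → V) :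
    Function.Injective (Fin.cons v b : Fin (q + 1) → V) ↔
      v ∉ image b univ ∧ Function.Injective b := by
  rw [Fin.cons_injective_iff]; simp

lemma inj_succAbove {q : ℕ} (a : Fin (q + 1) → V) (i : Fin (q + 1))
    (h1 : Function.Injective (a ∘ i.succAbove)) (h2 : a i ∉ image (a ∘ i.succAbove) univ) :
    Function.Injective a := by
  have h3 : ∀ k, a (i.succAbove k) ≠ a i := by
    intro k hk
    exact h2 (mem_image.2 ⟨k, mem_univ _, hk⟩)
  intro x y hxy
  rcases Fin.eq_self_or_eq_succAbove i x with hx | ⟨k, rfl⟩ <;>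
    rcases Fin.eq_self_or_eq_succAbove i y with hy | ⟨l, hy⟩
  · rw [hx, hy]
  · rw [hx, hy] at hxy; exact absurd hxy.symm (h3 l)
  · rw [hy] at hxy; exact absurd hxy (h3 k)
  · rw [hy] at hxy ⊢; rw [h1 hxy]

lemma cochain_lift {Y : Finset (Finset V)} (v : V) {q : ℕ} {h : (Fin q → V) → G}
    (hh : IsCochain (link Y {v}) h) : IsCochain Y (lift v h) := by
  refine ⟨anti_lift v hh.1, ?_⟩
  intro tup ht
  unfold lift
  refine sum_eq_zero fun i _ => ?_
  by_cases hi : tup i = v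
  · rw [if_pos hi, hh.2, smul_zero]
    rintro ⟨h1, h2⟩
    rw [mem_link] at h2
    apply ht
    refine ⟨inj_succAbove tup i h1 ?_, ?_⟩
    · rw [hi]; simpa using h2.1
    · rw [image_succAbove tup i, hi]; convert h2.2 using 1; ext; simp
  · rw [if_neg hi, smul_zero]

lemma lift_zero (v : V) {q : ℕ} (h : (Fin q → V) → G) (b : Fin (q + 1) → V)
    (hb : v ∉ image b univ) : lift v h b = 0 := by
  unfold lift
  refine sum_eq_zero fun i _ => ?_
  rw [if_neg, smul_zero]
  rintro rfl
  exact hb (mem_image_of_mem _ (mem_univ _))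

lemma lift_cons (v : V) {q : ℕ} (h : (Fin q → V) → G) (b : Fin q → V)
    (hb : v ∉ image b univ) : lift v h (Fin.cons v b) = h b := by
  unfold lift
  rw [sum_eq_single 0]
  · simp only [Fin.cons_zero, if_true, Fin.val_zero, pow_zero, one_smul]
    congr 1
  · intro i _ hi
    rw [if_neg, smul_zero]
    obtain ⟨j, rfl⟩ := Fin.exists_succ_eq.2 hi
    rw [Fin.cons_succ]
    rintro rfl
    exact hb (mem_image_of_mem _ (mem_univ _))
  · simp

lemma cob_lift_zero (v : V) {q : ℕ} (h : (Fin q → V) → G) (b : Fin (q + 2) → V)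
    (hb : v ∉ image b univ) : cob (lift v h) b = 0 := by
  unfold cob
  refine sum_eq_zero fun i _ => ?_
  rw [lift_zero, smul_zero]
  intro hh; apply hb
  rw [image_succAbove b i]; exact mem_insert_of_mem hh

lemma cob_lift_cons (v : V) {q : ℕ} (h : (Fin q → V) → G) (b : Fin (q + 1) → V)
    (hb : v ∉ image b univ) : cob (lift v h) (Fin.cons v b) = - cob h b := by
  rw [cob_cons, lift_zero _ _ _ hb, zero_sub]
  congr 1
  unfold cob
  refine sum_congr rfl fun i _ => ?_
  congr 1
  exact lift_cons _ _ _ fun hh => hb (by rw [image_succAbove b i]; exact mem_insert_of_mem hh)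

lemma localize_supp {Y : Finset (Finset V)} {q : ℕ} {F : (Fin (q + 2) → V) → G} (hF : Anti F)
    {H : (Fin (q + 1) → V) → G} (v : V)
    (hH : ∀ b, Function.Injective b → v ∉ image b univ → (H b ≠ 0 ↔ F (Fin.cons v b) ≠ 0)) :
    (facesCard Y (q + 1 + ({v} : Finset V).card)).filter
      (fun s => {v} ⊆ s ∧ ∃ tup : Fin (q + 1) → V, image tup univ = s \ {v} ∧ H tup ≠ 0) =
    (suppC Y F).filter (v ∈ ·) := by
  ext s
  simp only [mem_filter, mem_facesCard, card_singleton, singleton_subset_iff]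
  have key : ∀ tup : Fin (q + 1) → V, v ∈ s → s.card = q + 2 → image tup univ = s \ {v} →
      Function.Injective tup ∧ v ∉ image tup univ := by
    intro tup hv hc h
    constructor
    · have h1 : (image tup univ).card = (univ : Finset (Fin (q + 1))).card := by
        rw [h, card_sdiff_of_subset (by simpa using hv), hc]; simp
      simpa using card_image_iff.1 h1
    · rw [h]; simp
  constructor
  · rintro ⟨⟨h1, h2⟩, h3, tup, h4, h5⟩
    obtain ⟨k1, k2⟩ := key tup h3 h2 h4
    refine ⟨?_, h3⟩
    unfold suppC
    rw [mem_filter, mem_facesCard]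
    refine ⟨⟨h1, h2⟩, Fin.cons v tup, ?_, (hH tup k1 k2).1 h5⟩
    rw [image_cons, h4]; ext x; by_cases hx : x = v <;> simp [hx, h3]
  · rintro ⟨h1, h3⟩
    unfold suppC at h1
    rw [mem_filter, mem_facesCard] at h1
    obtain ⟨⟨h1, h2⟩, a, h4, h5⟩ := h1
    refine ⟨⟨h1, h2⟩, h3, ?_⟩
    obtain ⟨b, hb1, hb2⟩ := exists_tup (m := q + 1) (s := s \ {v}) (by
      rw [card_sdiff_of_subset (by simpa using h3), h2]; simp)
    obtain ⟨k1, k2⟩ := key b h3 h2 hb2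
    refine ⟨b, hb2, (hH b k1 k2).2 ?_⟩
    refine (anti_iff hF ((inj_cons v b).2 ⟨k2, k1⟩) ?_).1 h5
    rw [image_cons, h4, hb2]; ext x; by_cases hx : x = v <;> simp [hx, h3]

lemma minimal_localize {Y : Finset (Finset V)} {t q : ℕ} {F : (Fin (q + 2) → V) → G}
    (hF : Anti F) (hmin : IsMinimal Y t F) (v : V) (hN : 0 < w Y t ∅) (hq : q + 2 ≤ t) :
    IsMinimal (link Y {v}) (t - 1) (localizeC F v) := by
  intro h hh
  have hmn := hmin (lift v (fun b => - h b)) (cochain_lift v (by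
    refine ⟨fun tup π => ?_, fun tup ht => ?_⟩
    · simp only [hh.1 tup π, smul_neg]
    · simp only [hh.2 tup ht, neg_zero]))
  set F' : (Fin (q + 2) → V) → G := fun tup => F tup - cob (lift v (fun b => - h b)) tup with hF'
  have hah : Anti (fun b => - h b) := fun tup π => by simp only [hh.1 tup π, smul_neg]
  have hF'a : Anti F' := anti_sub hF (anti_cob (anti_lift v hah))
  rw [normC_eq, normC_eq] at hmn
  have hC : 0 < (t.choose (q + 2) : ℝ) := by exact_mod_cast Nat.choose_pos hq
  rw [div_le_div_iff_of_pos_right (by positivity)] at hmn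
  rw [normC_eq, normC_eq]
  have e1 := supp_link_sum Y t {v} (by simp; omega) (localizeC F v)
  have e2 := supp_link_sum Y t {v} (by simp; omega) (fun tup => localizeC F v tup - cob h tup)
  rw [localize_supp hF v (by intro b _ _; rfl)] at e1
  rw [localize_supp hF'a v (by
    intro b _ hb
    simp only [hF', cob_lift_cons v _ b hb, localizeC]
    have : cob (fun b => - h b) b = - cob h b := by simp [cob]
    rw [this, neg_neg])] at e2
  rw [card_singleton] at e1 e2
  rw [e1, e2]
  apply div_le_div_of_nonneg_right _ (mul_nonneg (w_nonneg _ _ _) (by positivity))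
  have e3 := sum_filter_add_sum_filter_not (suppC Y F) (v ∈ ·) (w Y t)
  have e4 := sum_filter_add_sum_filter_not (suppC Y F') (v ∈ ·) (w Y t)
  have e5 : (suppC Y F).filter (v ∉ ·) = (suppC Y F').filter (v ∉ ·) := by
    ext s
    unfold suppC
    simp only [mem_filter]
    have : ∀ tup : Fin (q + 2) → V, v ∉ image tup univ → F' tup = F tup := by
      intro tup ht
      simp only [hF', cob_lift_zero v _ tup ht, sub_zero]
    constructor
    · rintro ⟨⟨h1, tup, rfl, h2⟩, h3⟩
      exact ⟨⟨h1, tup, rfl, by rwa [this tup h3]⟩, h3⟩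
    · rintro ⟨⟨h1, tup, rfl, h2⟩, h3⟩
      exact ⟨⟨h1, tup, rfl, by rwa [this tup h3] at h2⟩, h3⟩
  rw [e5] at e3
  linarith
end HDXP

namespace HDXP
open HDX
variable {V : Type*} [Fintype V] [DecidableEq V] {G : Type*} [AddCommGroup G]

lemma link_coch {X : Finset (Finset V)} {d m : ℕ} (hX : IsComplex X) (hXd : IsPureDim X d)
    (hk : m + 2 ≤ d) {f : (Fin (m + 2) → V) → G} (hf : IsCocycle X f)
    (hmin : IsLocallyMinimal X (d + 1) f) :
    ∀ n, ∀ σ ∈ X, σ.card = n + 1 → ∀ q, q + σ.card = m + 1 →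
      ∃ F : (Fin (q + 1) → V) → G, IsCochain (link X σ) F ∧
        IsMinimal (link X σ) (d + 1 - σ.card) F ∧
        (∀ b, Function.Injective b → Disjoint (image b univ) σ →
          (F b ≠ 0 ↔ image b univ ∪ σ ∈ suppC X f)) ∧
        (∀ b : Fin (q + 2) → V, Function.Injective b → Disjoint (image b univ) σ →
          image b univ ∪ σ ∈ X → (∀ u ∈ σ, image b univ ∪ σ.erase u ∉ suppC X f) →
          cob F b = 0) := by
  intro n
  induction n with
  | zero =>
    intro σ hσ hc q hq
    obtain ⟨v, rfl⟩ := card_eq_one.1 hc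
    have hqm : q = m := by rw [hc] at hq; omega
    subst hqm
    refine ⟨localizeC f v, ⟨anti_localize hf.1.1 v, ?_⟩, ?_, ?_, ?_⟩
    · intro b hb
      apply hf.1.2
      rintro ⟨h1, h2⟩
      rw [inj_cons] at h1
      rw [image_cons] at h2
      apply hb
      refine ⟨h1.2, ?_⟩
      rw [mem_link]
      exact ⟨by simpa using h1.1, by convert h2 using 1; ext; simp⟩
    · have := hmin v hσ
      rwa [card_singleton]
    · intro b hb1 hb2
      have hi := (inj_cons v b).2 ⟨by simpa using hb2, hb1⟩
      have h1 := mem_suppC (Y := X) hf.1.1 hi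
      rw [image_cons] at h1
      have h2 : image b univ ∪ {v} = insert v (image b univ) := by ext; simp
      rw [h2, h1]
      unfold localizeC
      constructor
      · intro h
        refine ⟨?_, h⟩
        by_contra h3
        apply h
        apply hf.1.2
        rintro ⟨_, h4⟩
        rw [image_cons] at h4
        exact h3 h4
      · exact fun h => h.2
    · intro b hb1 hb2 hb3 hb4
      have h2 : image b univ ∪ {v} = insert v (image b univ) := by ext; simp
      have hi := (inj_cons v b).2 ⟨by simpa using hb2, hb1⟩
      have h3 := hf.2 (Fin.cons v b) ⟨hi, by rw [image_cons, ← h2]; exact hb3⟩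
      rw [cob_cons] at h3
      have h4 := hb4 v (by simp)
      have h5 : image b univ ∪ ({v} : Finset V).erase v = image b univ := by simp
      rw [h5, mem_suppC hf.1.1 hb1] at h4
      have h6 : f b = 0 := by
        by_contra h
        exact h4 ⟨hX _ hb3 _ subset_union_left, h⟩
      rw [h6, zero_sub, neg_eq_zero] at h3
      exact h3
  | succ n ih =>
    intro σ hσ hc q hq
    obtain ⟨v, hv⟩ : σ.Nonempty := card_pos.1 (by omega)
    have hc' : (σ.erase v).card = n + 1 := by rw [card_erase_of_mem hv]; omega
    have hσ' : σ.erase v ∈ X := hX _ hσ _ (erase_subset _ _)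
    obtain ⟨F, h1, h2, h3, h4⟩ := ih (σ.erase v) hσ' hc' (q + 1) (by omega)
    have hl := link_link X (σ.erase v) v (by simp)
    rw [insert_erase hv] at hl
    have hdj : ∀ s : Finset V, Disjoint s σ → v ∉ s ∧ Disjoint s (σ.erase v) := by
      intro s hs
      exact ⟨fun h => disjoint_left.1 hs h hv, hs.mono_right (erase_subset _ _)⟩
    have hun : ∀ s : Finset V, insert v s ∪ σ.erase v = s ∪ σ := by
      intro s; ext x; by_cases hx : x = v <;> simp [hx, hv]
    have hdi : ∀ s : Finset V, Disjoint s σ → Disjoint (insert v s) (σ.erase v) := by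
      intro s hs
      rw [disjoint_insert_left]; exact ⟨by simp, (hdj s hs).2⟩
    refine ⟨localizeC F v, ⟨anti_localize h1.1 v, ?_⟩, ?_, ?_, ?_⟩
    · intro b hb
      apply h1.2
      rintro ⟨k1, k2⟩
      rw [inj_cons] at k1
      rw [image_cons, mem_link, hun] at k2
      apply hb
      refine ⟨k1.2, ?_⟩
      rw [mem_link]
      refine ⟨?_, k2.2⟩
      rw [← insert_erase hv, disjoint_insert_right]
      exact ⟨k1.1, (disjoint_insert_left.1 k2.1).2⟩
    · have := minimal_localize h1.1 h2 v (by
        have e := w_link X (d + 1) (σ.erase v) ∅ (by omega) (disjoint_empty_left _)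
        rw [e, empty_union]
        exact w_pos hXd hσ') (by omega)
      rw [hl] at this
      convert this using 1
      omega
    · intro b hb1 hb2
      have hi := (inj_cons v b).2 ⟨(hdj _ hb2).1, hb1⟩
      have := h3 (Fin.cons v b) hi (by rw [image_cons]; exact hdi _ hb2)
      rw [image_cons, hun] at this
      exact this
    · intro b hb1 hb2 hb3 hb4
      have hi := (inj_cons v b).2 ⟨(hdj _ hb2).1, hb1⟩
      have k := h4 (Fin.cons v b) hi (by rw [image_cons]; exact hdi _ hb2)
        (by rw [image_cons, hun]; exact hb3) (by
          intro u hu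
          rw [image_cons]
          have := hb4 u (mem_of_mem_erase hu)
          convert this using 2
          have hne := ne_of_mem_erase hu
          ext x; by_cases hx : x = v
          · simp [hx, hv, hne.symm]
          · simp [hx])
      rw [cob_cons] at k
      have k2 : F b = 0 := by
        by_contra h
        exact hb4 v hv ((h3 b hb1 (hdj _ hb2).2).1 h)
      rw [k2, zero_sub, neg_eq_zero] at k
      exact k

lemma restrict_ineq {Y : Finset (Finset V)} {t q : ℕ} {β : ℝ} (hN : 0 < w Y t ∅)
    (hq : q + 2 ≤ t) (hY : IsCoboundaryExpander Y t G β) (hβ : 0 ≤ β)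
    {F : (Fin (q + 1) → V) → G} (hF : IsCochain Y F) (hmin : IsMinimal Y t F)
    (P : Finset V → Prop) [DecidablePred P] :
    β * normC Y t (fun b => if P (image b univ) then F b else 0) ≤
      normC Y t (cob fun b => if P (image b univ) then F b else 0) := by
  set g : (Fin (q + 1) → V) → G := fun b => if P (image b univ) then F b else 0 with hg
  have hgc : IsCochain Y g := by
    refine ⟨fun tup π => ?_, fun tup ht => ?_⟩
    · have : image (tup ∘ π) univ = image tup univ := by
        ext x; simp only [mem_image, mem_univ, true_and, Function.comp]
        exact ⟨fun ⟨i, h⟩ => ⟨_, h⟩, fun ⟨i, h⟩ => ⟨π.symm i, by simpa using h⟩⟩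
      simp only [hg, this]
      split_ifs
      · exact hF.1 tup π
      · simp
    · simp only [hg, hF.2 tup ht, ite_self]
  have hgm : ∀ h : (Fin q → V) → G, IsCochain Y h →
      normC Y t g ≤ normC Y t fun tup => g tup - cob h tup := by
    intro h hh
    have h1 := hmin h hh
    rw [normC_eq, normC_eq] at h1 ⊢
    have hC : 0 < (t.choose (q + 1) : ℝ) := by exact_mod_cast Nat.choose_pos (by omega)
    rw [div_le_div_iff_of_pos_right (by positivity)] at h1 ⊢
    have e1 := sum_filter_add_sum_filter_not (suppC Y F) P (w Y t)
    have e2 : (suppC Y F).filter P = suppC Y g := by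
      ext s
      unfold suppC
      simp only [mem_filter, hg]
      constructor
      · rintro ⟨⟨k1, tup, rfl, k2⟩, k3⟩
        exact ⟨k1, tup, rfl, by rwa [if_pos k3]⟩
      · rintro ⟨k1, tup, rfl, k2⟩
        by_cases k3 : P (image tup univ)
        · rw [if_pos k3] at k2
          exact ⟨⟨k1, tup, rfl, k2⟩, k3⟩
        · rw [if_neg k3] at k2; exact absurd rfl k2
    have e3 : suppC Y (fun tup => F tup - cob h tup) ⊆
        (suppC Y fun tup => g tup - cob h tup) ∪ (suppC Y F).filter (¬ P ·) := by
      intro s hs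
      unfold suppC at hs ⊢
      simp only [mem_filter, mem_union] at hs ⊢
      obtain ⟨k1, tup, rfl, k2⟩ := hs
      by_cases k3 : P (image tup univ)
      · left
        exact ⟨k1, tup, rfl, by simpa only [hg, if_pos k3] using k2⟩
      · by_cases k4 : F tup = 0
        · left
          refine ⟨k1, tup, rfl, ?_⟩
          simp only [hg, if_neg k3]
          rwa [k4] at k2
        · right
          exact ⟨⟨k1, tup, rfl, k4⟩, k3⟩
    have e4 := sum_le_sum_of_subset_of_nonneg e3 (f := w Y t) fun _ _ _ => w_nonneg _ _ _
    have e5 := sum_union_inter (s₁ := suppC Y fun tup => g tup - cob h tup)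
      (s₂ := (suppC Y F).filter (¬ P ·)) (f := w Y t)
    have e6 : 0 ≤ ∑ x ∈ (suppC Y fun tup => g tup - cob h tup) ∩ (suppC Y F).filter (¬ P ·),
      w Y t x := sum_nonneg fun _ _ => w_nonneg _ _ _
    rw [e2] at e1
    linarith
  have hnn : 0 ≤ normC Y t (cob g) := by
    rw [normC_eq]
    exact div_nonneg (sum_nonneg fun _ _ => w_nonneg _ _ _)
      (mul_nonneg (w_nonneg _ _ _) (by positivity))
  by_cases hb : IsCoboundaryFn Y g
  · obtain ⟨h, h1, h2⟩ := hb
    have h3 := hgm h h1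
    have h4 : normC Y t (fun tup => g tup - cob h tup) = 0 := by
      rw [normC_eq]
      have : suppC Y (fun tup => g tup - cob h tup) = ∅ := by
        rw [eq_empty_iff_forall_notMem]
        intro s hs
        unfold suppC at hs
        rw [mem_filter, mem_facesCard] at hs
        obtain ⟨⟨k1, k2⟩, tup, rfl, k3⟩ := hs
        apply k3
        change g tup - cob h tup = 0
        rw [h2 tup ⟨?_, k1⟩, sub_self]
        have : (image tup univ).card = (univ : Finset (Fin (q + 1))).card := by rw [k2]; simp
        simpa using card_image_iff.1 this
      rw [this]; simp
    rw [h4] at h3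
    have := mul_nonneg hβ (neg_nonneg.2 h3)
    linarith
  · have h1 := hY q hq g hgc hb
    have h2 : normC Y t g ≤ distB Y t g := by
      unfold distB
      apply le_csInf
      · refine ⟨_, fun _ => 0, ⟨fun _ _ => by simp, fun _ _ => rfl⟩, rfl⟩
      · rintro r ⟨h, h1, rfl⟩
        exact hgm h h1
    have := mul_le_mul_of_nonneg_left h2 hβ
    linarith

lemma per_sigma {X : Finset (Finset V)} {d m : ℕ} {β : ℝ} (hβ : 0 ≤ β) (hX : IsComplex X)
    (hXd : IsPureDim X d) (hlinks : HasCobExpandingLinks X d G β)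
    (hk : m + 2 ≤ d) {f : (Fin (m + 2) → V) → G} (hf : IsCocycle X f)
    (hmin : IsLocallyMinimal X (d + 1) f) {r : ℕ} {σ : Finset V} (hσ : σ ∈ X)
    (hcard : σ.card + r = m + 2) (hr : 1 ≤ r) (hσ1 : 1 ≤ σ.card)
    (𝒢 Δ : Finset (Finset V)) (h𝒢 : ∀ s ∈ 𝒢, s ∈ suppC X f ∧ σ ⊆ s)
    (hΔ : ∀ ρ ∈ X, ρ.card = m + 3 → σ ⊆ ρ → (∃ v ∈ ρ, ρ.erase v ∈ 𝒢) →
      (∃ u ∈ ρ, ρ.erase u ∈ suppC X f ∧ ρ.erase u ∉ 𝒢) → ρ ∈ Δ) :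
    β * ((d + 1 - (m + 2) : ℕ) : ℝ) * ∑ s ∈ 𝒢, w X (d + 1) s ≤
      ((r : ℝ) + 1) * ∑ ρ ∈ Δ, w X (d + 1) ρ := by
  obtain ⟨q, rfl⟩ : ∃ q, r = q + 1 := ⟨r - 1, by omega⟩
  obtain ⟨F, h1, h2, h3, h4⟩ := link_coch hX hXd hk hf hmin (σ.card - 1) σ hσ (by omega) q
    (by omega)
  have hN : w (link X σ) (d + 1 - σ.card) ∅ = w X (d + 1) σ := by
    rw [w_link X (d + 1) σ ∅ (by omega) (disjoint_empty_left _), empty_union]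
  have hwp := w_pos hXd hσ
  have key := restrict_ineq (by rw [hN]; exact hwp) (by omega)
    (hlinks σ hσ (card_pos.1 hσ1)) hβ h1 h2 (fun s => s ∪ σ ∈ 𝒢)
  set g : (Fin (q + 1) → V) → G := fun b => if image b univ ∪ σ ∈ 𝒢 then F b else 0 with hg
  rw [normC_eq, normC_eq, hN, supp_link_sum X (d + 1) σ (by omega),
    supp_link_sum X (d + 1) σ (by omega)] at key
  have k1 : (facesCard X (q + 1 + σ.card)).filter
      (fun s => σ ⊆ s ∧ ∃ tup : Fin (q + 1) → V, image tup univ = s \ σ ∧ g tup ≠ 0) = 𝒢 := by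
    ext s
    rw [mem_filter, mem_facesCard]
    constructor
    · rintro ⟨_, h5, tup, h6, h7⟩
      by_contra h8
      apply h7
      simp only [hg, h6, sdiff_union_of_subset h5, if_neg h8]
    · intro hs
      obtain ⟨h5, h6⟩ := h𝒢 s hs
      obtain ⟨h7, h8⟩ := mem_facesCard.1 (suppC_sub _ h5)
      refine ⟨⟨h7, by omega⟩, h6, ?_⟩
      obtain ⟨b, hb1, hb2⟩ := exists_tup (m := q + 1) (s := s \ σ) (by
        rw [card_sdiff_of_subset h6]; omega)
      refine ⟨b, hb2, ?_⟩
      have h9 := (h3 b hb1 (by rw [hb2]; exact sdiff_disjoint)).2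
        (by rwa [hb2, sdiff_union_of_subset h6])
      simp only [hg, hb2, sdiff_union_of_subset h6, if_pos hs]
      exact h9
  have k2 : (facesCard X (q + 1 + 1 + σ.card)).filter
      (fun s => σ ⊆ s ∧ ∃ tup : Fin (q + 1 + 1) → V, image tup univ = s \ σ ∧ cob g tup ≠ 0)
        ⊆ Δ := by
    intro ρ hρ
    rw [mem_filter, mem_facesCard] at hρ
    obtain ⟨⟨h5, h6⟩, h7, b, h8, h9⟩ := hρ
    have hbi : Function.Injective b := by
      have : (image b univ).card = (univ : Finset (Fin (q + 1 + 1))).card := by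
        rw [h8, card_sdiff_of_subset h7, h6]; simp
      simpa using card_image_iff.1 this
    have hbρ : ∀ i, b i ∈ ρ \ σ := by
      intro i; rw [← h8]; exact mem_image_of_mem _ (mem_univ _)
    have her : ∀ i : Fin (q + 1 + 1), image (b ∘ i.succAbove) univ ∪ σ = ρ.erase (b i) := by
      intro i
      have e1 : image (b ∘ i.succAbove) univ = (ρ \ σ).erase (b i) := by
        rw [← h8, image_succAbove b i, erase_insert]
        intro hh
        obtain ⟨j, _, hj⟩ := mem_image.1 hh
        exact Fin.succAbove_ne i j (hbi hj)
      rw [e1]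
      ext x
      have := (mem_sdiff.1 (hbρ i)).2
      simp only [mem_union, mem_erase, mem_sdiff]
      constructor
      · rintro (h | h)
        · exact ⟨h.1, h.2.1⟩
        · exact ⟨fun hh => this (hh ▸ h), h7 h⟩
      · intro h
        by_cases hx : x ∈ σ
        · exact Or.inr hx
        · exact Or.inl ⟨h.1, h.2, hx⟩
    have hdis : ∀ i : Fin (q + 1 + 1), Disjoint (image (b ∘ i.succAbove) univ) σ := by
      intro i
      have : image (b ∘ i.succAbove) univ ⊆ ρ \ σ := by
        rw [← h8, image_succAbove b i]; exact subset_insert _ _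
      exact sdiff_disjoint.mono_left this
    have hinj : ∀ i : Fin (q + 1 + 1), Function.Injective (b ∘ i.succAbove) := fun i =>
      hbi.comp Fin.succAbove_right_injective
    apply hΔ ρ h5 (by omega) h7
    · by_contra hno
      push Not at hno
      apply h9
      unfold cob
      refine sum_eq_zero fun i _ => ?_
      simp only [hg]
      rw [her, if_neg (hno _ (mem_sdiff.1 (hbρ i)).1), smul_zero]
    · by_contra hno
      push Not at hno
      apply h9
      have e1 : cob g b = cob F b := by
        unfold cob
        refine sum_congr rfl fun i _ => ?_
        congr 1
        simp only [hg]
        rw [her]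
        split_ifs with hh
        · rfl
        · by_contra hne
          have := (h3 _ (hinj i) (hdis i)).1 (Ne.symm hne)
          rw [her] at this
          exact hh (hno _ (mem_sdiff.1 (hbρ i)).1 this)
      rw [e1]
      apply h4 b hbi (by rw [h8]; exact sdiff_disjoint) (by
        rw [h8, sdiff_union_of_subset h7]; exact h5)
      intro u hu hA
      have e2 : image b univ ∪ σ.erase u = ρ.erase u := by
        rw [h8]
        ext x
        simp only [mem_union, mem_erase, mem_sdiff]
        constructor
        · rintro (h | h)
          · exact ⟨fun hh => h.2 (hh ▸ hu), h.1⟩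
          · exact ⟨h.1, h7 h.2⟩
        · intro h
          by_cases hx : x ∈ σ
          · exact Or.inr ⟨h.1, hx⟩
          · exact Or.inl ⟨h.2, hx⟩
      rw [e2] at hA
      have := (h𝒢 _ (hno u (h7 hu) hA)).2 hu
      simp at this
  rw [k1] at key
  have k3 := sum_le_sum_of_subset_of_nonneg k2 (f := w X (d + 1)) fun _ _ _ => w_nonneg _ _ _
  have k4 := Nat.choose_succ_right_eq (d + 1 - σ.card) (q + 1)
  have k5 : d + 1 - σ.card - (q + 1) = d + 1 - (m + 2) := by omega
  rw [k5] at k4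
  have k6 : ((d + 1 - σ.card).choose (q + 1 + 1) : ℝ) * ((q + 1 : ℕ) + 1 : ℝ) =
      ((d + 1 - σ.card).choose (q + 1) : ℝ) * ((d + 1 - (m + 2) : ℕ) : ℝ) := by exact_mod_cast k4
  have c1 : 0 < ((d + 1 - σ.card).choose (q + 1) : ℝ) := by
    exact_mod_cast Nat.choose_pos (by omega)
  have c2 : 0 < ((d + 1 - σ.card).choose (q + 1 + 1) : ℝ) := by
    exact_mod_cast Nat.choose_pos (by omega)
  rw [← mul_div_assoc, div_le_div_iff₀ (by positivity) (by positivity)] at key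
  set a := ∑ s ∈ 𝒢, w X (d + 1) s
  set D := ∑ s ∈ Δ, w X (d + 1) s
  generalize ∑ s ∈ _, w X (d + 1) s = D' at key k3
  set n1 := ((d + 1 - σ.card).choose (q + 1) : ℝ)
  set n2 := ((d + 1 - σ.card).choose (q + 1 + 1) : ℝ)
  set W0 := w X (d + 1) σ
  have k7 : β * a * n2 ≤ D' * n1 := by
    have : W0 * (β * a * n2) ≤ W0 * (D' * n1) := by linarith
    exact le_of_mul_le_mul_left this hwp
  have k8 : n1 * (β * ((d + 1 - (m + 2) : ℕ) : ℝ) * a) ≤ n1 * ((((q + 1 : ℕ) : ℝ) + 1) * D) := by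
    calc n1 * (β * ((d + 1 - (m + 2) : ℕ) : ℝ) * a)
        = (β * a) * (n1 * ((d + 1 - (m + 2) : ℕ) : ℝ)) := by ring
      _ = (β * a * n2) * (((q + 1 : ℕ) : ℝ) + 1) := by rw [← k6]; ring
      _ ≤ (D' * n1) * (((q + 1 : ℕ) : ℝ) + 1) := mul_le_mul_of_nonneg_right k7 (by positivity)
      _ ≤ (D * n1) * (((q + 1 : ℕ) : ℝ) + 1) :=
          mul_le_mul_of_nonneg_right (mul_le_mul_of_nonneg_right k3 c1.le) (by positivity)
      _ = _ := by ring
  exact le_of_mul_le_mul_left k8 c1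
end HDXP

namespace HDXP
open HDX
variable {V : Type*} [Fintype V] [DecidableEq V] {G : Type*} [AddCommGroup G]

noncomputable def DD (X : Finset (Finset V)) (t c : ℕ) (A : Finset (Finset V)) (η : ℝ)
    (r : ℕ) : ℝ :=
  ∑ σ ∈ S X t c A η r, ∑ s ∈ A.filter (fun s => Ch X t c A η r s σ), w X t s

lemma DD_second {X : Finset (Finset V)} {t c : ℕ} {A : Finset (Finset V)} {η : ℝ}
    (hA : A ⊆ facesCard X c) (r : ℕ) :
    ∑ σ ∈ S X t c A η r, ∑ ρ ∈ (facesCard X (c + 1)).filter (fun ρ => σ ⊆ ρ ∧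
      ∃ u ∈ σ, Ch X t c A η (r + 1) (ρ.erase u) (σ.erase u)), w X t ρ ≤
    ((t - c : ℕ) : ℝ) * DD X t c A η (r + 1) := by
  set T1 : Finset (Finset V × Finset V × V) :=
    (S X t c A η r ×ˢ (facesCard X (c + 1) ×ˢ (univ : Finset V))).filter
      (fun p => (p.1 ⊆ p.2.1 ∧ p.2.2 ∈ p.1) ∧
        Ch X t c A η (r + 1) (p.2.1.erase p.2.2) (p.1.erase p.2.2)) with hT1
  set T2 : Finset (Finset V × Finset V × V) :=
    (S X t c A η (r + 1) ×ˢ (A ×ˢ (univ : Finset V))).filter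
      (fun p => Ch X t c A η (r + 1) p.2.1 p.1 ∧ p.2.2 ∉ p.2.1) with hT2
  have h1 : ∑ σ ∈ S X t c A η r, ∑ ρ ∈ (facesCard X (c + 1)).filter (fun ρ => σ ⊆ ρ ∧
      ∃ u ∈ σ, Ch X t c A η (r + 1) (ρ.erase u) (σ.erase u)), w X t ρ ≤
      ∑ p ∈ T1, w X t p.2.1 := by
    rw [hT1, sum_filter, sum_product]
    refine sum_le_sum fun σ _ => ?_
    rw [sum_product, sum_filter]
    refine sum_le_sum fun ρ _ => ?_
    simp only []
    split_ifs with h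
    · obtain ⟨h2, u, hu, h3⟩ := h
      have := single_le_sum (f := fun y => if (σ ⊆ ρ ∧ y ∈ σ) ∧
        Ch X t c A η (r + 1) (ρ.erase y) (σ.erase y) then w X t ρ else 0)
        (fun y _ => by
          split_ifs
          · exact w_nonneg _ _ _
          · exact le_refl _) (mem_univ u)
      simp only [h2, hu, h3, and_self, if_true] at this
      simpa only [h2] using this
    · refine sum_nonneg fun y _ => ?_
      split_ifs
      · exact w_nonneg _ _ _
      · exact le_refl _
  have h2 : ∑ p ∈ T2, w X t (insert p.2.2 p.2.1) = ((t - c : ℕ) : ℝ) * DD X t c A η (r + 1) := by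
    rw [hT2, sum_filter, sum_product, DD, mul_sum]
    refine sum_congr rfl fun σ _ => ?_
    rw [sum_product, sum_filter, mul_sum]
    refine sum_congr rfl fun s hs => ?_
    simp only []
    by_cases h : Ch X t c A η (r + 1) s σ
    · simp only [h, true_and, if_true]
      rw [← sum_filter, sum_ext1, (mem_facesCard.1 (hA hs)).2, mul_comm]
    · simp [h]
  rw [← h2]
  refine h1.trans ?_
  have hinj : Set.InjOn (fun p : Finset V × Finset V × V =>
      (p.1.erase p.2.2, p.2.1.erase p.2.2, p.2.2)) T1 := by
    rintro ⟨σ, ρ, u⟩ hp ⟨σ', ρ', u'⟩ hp' heq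
    rw [mem_coe, hT1, mem_filter] at hp hp'
    simp only [Prod.mk.injEq] at heq
    obtain ⟨e1, e2, rfl⟩ := heq
    simp only at hp hp' e1 e2
    have a1 := hp.2.1
    have a2 := hp'.2.1
    rw [← insert_erase a1.2, e1, insert_erase a2.2, ← insert_erase (a1.1 a1.2), e2,
      insert_erase (a2.1 a2.2)]
  have h3 : ∑ p ∈ T1, w X t p.2.1 = ∑ p ∈ T1.image (fun p : Finset V × Finset V × V =>
      (p.1.erase p.2.2, p.2.1.erase p.2.2, p.2.2)), w X t (insert p.2.2 p.2.1) := by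
    rw [sum_image hinj]
    refine sum_congr rfl fun p hp => ?_
    rw [hT1, mem_filter] at hp
    simp only []
    rw [insert_erase (hp.2.1.1 hp.2.1.2)]
  rw [h3]
  refine sum_le_sum_of_subset_of_nonneg ?_ fun _ _ _ => w_nonneg _ _ _
  intro p hp
  obtain ⟨⟨σ, ρ, u⟩, hq, rfl⟩ := mem_image.1 hp
  clear hp
  have hp := hq
  rw [hT1, mem_filter] at hp
  rw [hT2, mem_filter, mem_product, mem_product]
  exact ⟨⟨Ch_S hp.2.2, (Ch_A hp.2.2).1, mem_univ _⟩, hp.2.2, by simp⟩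

lemma DD_step {X : Finset (Finset V)} {d m : ℕ} {β η : ℝ} (hβ : 0 ≤ β) (hX : IsComplex X)
    (hXd : IsPureDim X d) (hlinks : HasCobExpandingLinks X d G β)
    (hk : m + 2 ≤ d) {f : (Fin (m + 2) → V) → G} (hf : IsCocycle X f)
    (hmin : IsLocallyMinimal X (d + 1) f) {r : ℕ} (hr : 1 ≤ r) (hrc : r < m + 2) {E : ℝ}
    (hE : ((m + 2 : ℕ) + 1 : ℝ) * W X (d + 1) (Ups X (d + 1) (m + 2) (suppC X f) η) ≤
      ((d + 1 - (m + 2) : ℕ) : ℝ) * E) :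
    β * DD X (d + 1) (m + 2) (suppC X f) η r ≤
      ((m + 2).choose r : ℝ) * E + ((r : ℝ) + 1) * DD X (d + 1) (m + 2) (suppC X f) η (r + 1) := by
  set A := suppC X f with hAdef
  have hA : A ⊆ facesCard X (m + 2) := suppC_sub f
  set U := Ups X (d + 1) (m + 2) A η with hU
  have hUs : U ⊆ facesCard X (m + 2 + 1) := filter_subset _ _
  have h1 : ∀ σ ∈ S X (d + 1) (m + 2) A η r,
      β * ((d + 1 - (m + 2) : ℕ) : ℝ) *
        ∑ s ∈ A.filter (fun s => Ch X (d + 1) (m + 2) A η r s σ), w X (d + 1) s ≤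
      ((r : ℝ) + 1) * (∑ ρ ∈ U.filter (fun ρ => σ ⊆ ρ), w X (d + 1) ρ +
        ∑ ρ ∈ (facesCard X (m + 2 + 1)).filter (fun ρ => σ ⊆ ρ ∧
      ∃ u ∈ σ, Ch X (d + 1) (m + 2) A η (r + 1) (ρ.erase u) (σ.erase u)), w X (d + 1) ρ) := by
    intro σ hσ
    have hc := S_card hA hσ
    have k1 := per_sigma hβ hX hXd hlinks hk hf hmin (r := r) (S_mem hA hσ) (by omega) hr
      (by omega) (A.filter (fun s => Ch X (d + 1) (m + 2) A η r s σ))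
      (U.filter (fun ρ => σ ⊆ ρ) ∪ (facesCard X (m + 2 + 1)).filter (fun ρ => σ ⊆ ρ ∧
      ∃ u ∈ σ, Ch X (d + 1) (m + 2) A η (r + 1) (ρ.erase u) (σ.erase u)))
      (by
        intro s hs
        rw [mem_filter] at hs
        exact ⟨hs.1, (Ch_A hs.2).2⟩)
      (by
        rintro ρ hρ hρc hσρ ⟨v, hv, hv2⟩ ⟨u, hu, huA, hu2⟩
        rw [mem_filter] at hv2 hu2
        rw [mem_union, mem_filter, mem_filter, mem_facesCard]
        by_cases hg : Good X (d + 1) (m + 2) A η ρ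
        · right
          refine ⟨⟨hρ, hρc⟩, hσρ, ?_⟩
          have := chain_step hA hρc hg hu huA (by omega) (erase_subset v ρ) hv2.2
          by_cases huσ : u ∈ σ
          · exact ⟨u, huσ, this.1 huσ⟩
          · exact absurd ⟨huA, this.2 huσ⟩ hu2
        · left
          refine ⟨?_, hσρ⟩
          rw [hU, Ups, mem_filter, mem_facesCard]
          exact ⟨⟨hρ, hρc⟩, hg⟩)
    refine k1.trans (mul_le_mul_of_nonneg_left ?_ (by positivity))
    rw [← sum_union_inter]
    have : 0 ≤ ∑ x ∈ U.filter (fun ρ => σ ⊆ ρ) ∩ (facesCard X (m + 2 + 1)).filter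
      (fun ρ => σ ⊆ ρ ∧ ∃ u ∈ σ, Ch X (d + 1) (m + 2) A η (r + 1) (ρ.erase u) (σ.erase u)),
      w X (d + 1) x := sum_nonneg fun _ _ => w_nonneg _ _ _
    linarith
  have h2 := sum_le_sum h1
  rw [← mul_sum, ← mul_sum, sum_add_distrib] at h2
  have h3 := DD_second (X := X) (t := d + 1) (η := η) hA r
  have h4 := sum_sub_le (X := X) (t := d + 1) U (S X (d + 1) (m + 2) A η r) (m + 2 + 1)
    (m + 2 - r) (fun s hs => (mem_facesCard.1 (hUs hs)).2) (fun s hs => S_card hA hs)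
  have h5 : (m + 2 + 1).choose (m + 2 - r) * (r + 1) = (m + 2 + 1) * (m + 2).choose r := by
    rw [Nat.choose_symm_of_eq_add (show m + 2 + 1 = (m + 2 - r) + (r + 1) by omega)]
    rw [← Nat.add_one_mul_choose_eq]
  have h6 : ((m + 2 + 1).choose (m + 2 - r) : ℝ) * ((r : ℝ) + 1) =
      ((m + 2 : ℕ) + 1 : ℝ) * ((m + 2).choose r : ℝ) := by exact_mod_cast h5
  have htc : 0 < ((d + 1 - (m + 2) : ℕ) : ℝ) := by
    have : 0 < d + 1 - (m + 2) := by omega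
    exact_mod_cast this
  change β * ((d + 1 - (m + 2) : ℕ) : ℝ) * DD X (d + 1) (m + 2) A η r ≤ _ at h2
  refine le_of_mul_le_mul_left ?_ htc
  set T := ((d + 1 - (m + 2) : ℕ) : ℝ)
  set R := (r : ℝ) + 1 with hR
  have hR0 : 0 ≤ R := by positivity
  have h7 := mul_le_mul_of_nonneg_left (add_le_add h4 h3) hR0
  have h8 := mul_le_mul_of_nonneg_left hE (show 0 ≤ ((m + 2).choose r : ℝ) by positivity)
  calc T * (β * DD X (d + 1) (m + 2) A η r) = β * T * DD X (d + 1) (m + 2) A η r := by ring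
    _ ≤ _ := h2.trans h7
    _ = (((m + 2 + 1).choose (m + 2 - r) : ℝ) * R) * W X (d + 1) U +
      T * (R * DD X (d + 1) (m + 2) A η (r + 1)) := by ring
    _ = ((m + 2).choose r : ℝ) * (((m + 2 : ℕ) + 1 : ℝ) * W X (d + 1) U) +
      T * (R * DD X (d + 1) (m + 2) A η (r + 1)) := by rw [h6]; ring
    _ ≤ ((m + 2).choose r : ℝ) * (T * E) + T * (R * DD X (d + 1) (m + 2) A η (r + 1)) := by
      linarith
    _ = _ := by ring

lemma recursion (D : ℕ → ℝ) (c : ℕ) (β E : ℝ) (hβ : 0 < β) (hβ1 : β ≤ 1) (hE : 0 ≤ E)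
    (h0 : D c = 0)
    (hs : ∀ r, 1 ≤ r → r < c → β * D r ≤ (c.choose r : ℝ) * E + ((r : ℝ) + 1) * D (r + 1)) :
    ∀ j r, 1 ≤ r → r + j = c → β ^ j * D r ≤ (c.choose r : ℝ) * ((j + 1).factorial : ℝ) * E := by
  intro j
  induction j with
  | zero =>
    intro r hr hc
    have : r = c := by omega
    subst this
    simp [h0, hE]
  | succ j ih =>
    intro r hr hc
    have h1 := hs r hr (by omega)
    have h2 := ih (r + 1) (by omega) (by omega)
    have h3 := Nat.choose_succ_right_eq c r
    have h3' : c - r = j + 1 := by omega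
    rw [h3'] at h3
    have h4 : (c.choose (r + 1) : ℝ) * ((r : ℝ) + 1) = (c.choose r : ℝ) * ((j : ℝ) + 1) := by
      exact_mod_cast h3
    have h5 : ((j + 1 + 1).factorial : ℝ) = ((j : ℝ) + 1) * ((j + 1).factorial : ℝ) +
        ((j + 1).factorial : ℝ) := by
      rw [Nat.factorial_succ (j + 1)]; push_cast; ring
    have h6 : (1 : ℝ) ≤ ((j + 1).factorial : ℝ) := by exact_mod_cast Nat.factorial_pos _
    have hb : β ^ j ≤ 1 := pow_le_one₀ hβ.le hβ1
    have hb0 : 0 ≤ β ^ j := by positivity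
    have hC : 0 ≤ (c.choose r : ℝ) * E := by positivity
    calc β ^ (j + 1) * D r = β ^ j * (β * D r) := by ring
      _ ≤ β ^ j * ((c.choose r : ℝ) * E + ((r : ℝ) + 1) * D (r + 1)) :=
        mul_le_mul_of_nonneg_left h1 hb0
      _ = β ^ j * ((c.choose r : ℝ) * E) + ((r : ℝ) + 1) * (β ^ j * D (r + 1)) := by ring
      _ ≤ ((j + 1).factorial : ℝ) * ((c.choose r : ℝ) * E) +
          ((r : ℝ) + 1) * ((c.choose (r + 1) : ℝ) * ((j + 1).factorial : ℝ) * E) := by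
        refine add_le_add (mul_le_mul_of_nonneg_right (hb.trans h6) hC)
          (mul_le_mul_of_nonneg_left h2 (by positivity))
      _ = ((j + 1).factorial : ℝ) * ((c.choose r : ℝ) * E) +
          ((c.choose (r + 1) : ℝ) * ((r : ℝ) + 1)) * (((j + 1).factorial : ℝ) * E) := by ring
      _ = _ := by rw [h4, h5]; ring

lemma final_nonlocal {X : Finset (Finset V)} {d m : ℕ} (hX : IsComplex X)
    (hXd : IsPureDim X d) (hk : m + 2 ≤ d) {A : Finset (Finset V)}
    (hA : A ⊆ facesCard X (m + 2)) {η ε : ℝ}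
    (hD : DD X (d + 1) (m + 2) A η 1 ≤ ((m + 2 : ℕ) : ℝ) * ε * W X (d + 1) A) :
    IsNonlocal X (d + 1) (m + 1) A η ε := by
  have hAc : ∀ s ∈ A, s.card = m + 2 := fun s hs => (mem_facesCard.1 (hA hs)).2
  unfold IsNonlocal
  change mwt X (d + 1) (m + 2) (m + 1) A _ ≥ (1 - ε) * wt X (d + 1) (m + 2) A
  rw [mwt_eq _ _ _ _ _ _ hAc, wt_eq _ _ _ _ hAc]
  have hch : (m + 2).choose (m + 1) = m + 2 := Nat.choose_succ_self_right (m + 1)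
  rw [hch]
  have hem : ∅ ∈ X := by
    obtain ⟨s, hs⟩ := hXd.1
    exact hX s hs _ (empty_subset _)
  have hN := w_pos hXd hem
  have hC : 0 < ((d + 1).choose (m + 2) : ℝ) := by exact_mod_cast Nat.choose_pos (by omega)
  have hDD : DD X (d + 1) (m + 2) A η 1 = ∑ s ∈ A, w X (d + 1) s *
      (((S X (d + 1) (m + 2) A η 1).filter (fun σ => σ ⊆ s)).card : ℝ) := by
    unfold DD
    simp_rw [sum_filter]
    rw [sum_comm]
    refine sum_congr rfl fun s hs => ?_
    rw [← sum_filter, sum_const, nsmul_eq_mul, mul_comm]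
    congr 3
    ext σ
    simp only [mem_filter, Ch_one]
    tauto
  have hmain : ((m + 2 : ℕ) : ℝ) * W X (d + 1) A ≤ (∑ s ∈ A, w X (d + 1) s *
      (((s.powersetCard (m + 1)).filter (· ∈ nonlocalS X (d + 1) (m + 1) A η)).card : ℝ)) +
      DD X (d + 1) (m + 2) A η 1 := by
    rw [hDD, ← sum_add_distrib, W, mul_sum]
    refine sum_le_sum fun s hs => ?_
    rw [← mul_add, mul_comm]
    refine mul_le_mul_of_nonneg_left ?_ (w_nonneg _ _ _)
    have e1 := card_filter_add_card_filter_not (s := s.powersetCard (m + 1))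
      (fun σ => σ ∈ nonlocalS X (d + 1) (m + 1) A η)
    rw [card_powersetCard, hAc s hs, hch] at e1
    have e2 : (s.powersetCard (m + 1)).filter (fun σ => ¬ σ ∈ nonlocalS X (d + 1) (m + 1) A η) ⊆
        (S X (d + 1) (m + 2) A η 1).filter (fun σ => σ ⊆ s) := by
      intro σ hσ
      rw [mem_filter, mem_powersetCard] at hσ
      obtain ⟨⟨k1, k2⟩, k3⟩ := hσ
      have hσX : σ ∈ X := hX s (mem_facesCard.1 (hA hs)).1 σ k1
      rw [mem_filter]
      refine ⟨?_, k1⟩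
      unfold S
      rw [mem_filter, mem_facesCard]
      refine ⟨⟨hσX, by rw [k2]; rfl⟩, ?_⟩
      unfold nonlocalS at k3
      rw [mem_filter, mem_facesCard] at k3
      have k4 : η < locWt X (d + 1) A (m + 1 + 1) σ := by
        by_contra h
        exact k3 ⟨⟨hσX, k2⟩, not_lt.1 h⟩
      rw [locWt_eq X (d + 1) (m + 1 + 1) A σ (by omega) hAc, k2] at k4
      have k5 : m + 1 + 1 - (m + 1) = 1 := by omega
      rw [k5, Nat.choose_one_right, lt_div_iff₀] at k4
      · have k6 : m + 2 - (0 + 1) = m + 1 := by omega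
        rw [k6, pow_zero, pow_one]
        exact k4
      · have : 0 < d + 1 - (m + 1) := by omega
        have h' : (0 : ℝ) < ((d + 1 - (m + 1) : ℕ) : ℝ) := by exact_mod_cast this
        exact mul_pos (w_pos hXd hσX) h'
    have e3 := card_le_card e2
    have e4 : m + 2 ≤ ((s.powersetCard (m + 1)).filter
      (· ∈ nonlocalS X (d + 1) (m + 1) A η)).card +
      ((S X (d + 1) (m + 2) A η 1).filter (fun σ => σ ⊆ s)).card := by omega
    exact_mod_cast e4
  have hm : (0 : ℝ) < ((m + 2 : ℕ) : ℝ) := by positivity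
  rw [ge_iff_le, le_div_iff₀ (by positivity)]
  change (1 - ε) * (W X (d + 1) A / _) * _ ≤ _
  have : (1 - ε) * (W X (d + 1) A / (w X (d + 1) ∅ * ((d + 1).choose (m + 2) : ℝ))) *
      (w X (d + 1) ∅ * ((d + 1).choose (m + 2) : ℝ) * ((m + 2 : ℕ) : ℝ)) =
      (1 - ε) * W X (d + 1) A * ((m + 2 : ℕ) : ℝ) := by
    field_simp
  rw [this]
  linarith

end HDXP


open HDXP

/-- Small and locally minimal cocycles are non-local: with
`η = β^(d-1)·ε/(2^d·((d+1)!)²)` and `λ = η^(2^(d-1))`, in a `d`-dimensional `λ`-local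
spectral expander with `β`-coboundary expanding links over `G`, every locally minimal
cocycle `f ∈ Z^k(X;G)` (`1 ≤ k ≤ d-1`, here `k = m+1`) with `‖f‖ ≤ η^(2^(k+1)-1)` has
`(η,ε)`-non-local support. -/
theorem stmt2 {V : Type*} [Fintype V] [DecidableEq V] {G : Type*} [AddCommGroup G]
    (d : ℕ) (β ε : ℝ) (hβ0 : 0 < β) (hβ1 : β < 1) (hε0 : 0 < ε) (hε1 : ε < 1)
    (η lam : ℝ)
    (hη : η = β ^ (d - 1) * ε / (2 ^ d * ((d + 1).factorial : ℝ) ^ 2))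
    (hlam : lam = η ^ 2 ^ (d - 1))
    (X : Finset (Finset V)) (hX : HDX.IsComplex X) (hXd : HDX.IsPureDim X d)
    (hlse : HDX.IsLocalSpectralExpander X d lam)
    (hlinks : HDX.HasCobExpandingLinks X d G β)
    (m : ℕ) (hk : m + 2 ≤ d)
    (f : (Fin (m + 2) → V) → G) (hf : HDX.IsCocycle X f)
    (hsmall : HDX.normC X (d + 1) f ≤ η ^ (2 ^ (m + 2) - 1))
    (hmin : HDX.IsLocallyMinimal X (d + 1) f) :
    HDX.IsNonlocal X (d + 1) (m + 1) (HDX.suppC X f) η ε := by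
  have hA : HDX.suppC X f ⊆ HDX.facesCard X (m + 2) := suppC_sub f
  have hfac : (1 : ℝ) ≤ ((d + 1).factorial : ℝ) := by exact_mod_cast Nat.factorial_pos _
  have hη0 : 0 < η := by rw [hη]; positivity
  have hη1 : η ≤ 1 := by
    rw [hη]
    apply div_le_one_of_le₀ _ (by positivity)
    have a1 : β ^ (d - 1) * ε ≤ 1 := mul_le_one₀ (pow_le_one₀ hβ0.le hβ1.le) hε0.le hε1.le
    have a2 : (1 : ℝ) ≤ 2 ^ d * ((d + 1).factorial : ℝ) ^ 2 :=
      one_le_mul_of_one_le_of_one_le (one_le_pow₀ (by norm_num)) (one_le_pow₀ hfac)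
    linarith
  have hle : ∀ r < m + 2, lam ≤ η ^ 2 ^ r := by
    intro r hr
    rw [hlam]
    exact pow_le_pow_of_le_one hη0.le hη1 (Nat.pow_le_pow_right (by norm_num) (by omega))
  have hlam0 : 0 ≤ lam := by rw [hlam]; positivity
  have hU := Ups_bound hXd hlam0 hlse hX hA (by omega) hle hη0
  have hem : ∅ ∈ X := by
    obtain ⟨s, hs⟩ := hXd.1
    exact hX s hs _ (empty_subset _)
  have hN := w_pos hXd hem
  have hC : 0 < ((d + 1).choose (m + 2) : ℝ) := by exact_mod_cast Nat.choose_pos (by omega)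
  have hW : 0 ≤ W X (d + 1) (HDX.suppC X f) := W_nonneg _
  have htop : S X (d + 1) (m + 2) (HDX.suppC X f) η (m + 2) = ∅ := by
    apply S_top_empty hA hη0 (by omega) (by omega)
    rw [normC_eq, div_le_iff₀ (by positivity)] at hsmall
    exact hsmall
  apply final_nonlocal hX hXd hk hA
  set W0 := W X (d + 1) (HDX.suppC X f)
  have hrec := recursion (DD X (d + 1) (m + 2) (HDX.suppC X f) η) (m + 2) β _ hβ0 hβ1.le
    (by positivity) (by unfold DD; rw [htop]; simp)
    (fun r hr hrc => DD_step hβ0.le hX hXd hlinks hk hf hmin hr hrc hU) (m + 1) 1 (by omega)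
    (by omega)
  rw [Nat.choose_one_right] at hrec
  have b1 : β ^ (d - 1) ≤ β ^ (m + 1) := pow_le_pow_of_le_one hβ0.le hβ1.le (by omega)
  have hb : 0 < β ^ (m + 1) := by positivity
  refine le_of_mul_le_mul_left (hrec.trans ?_) hb
  have n1 : (m + 2).factorial * (2 ^ (m + 2) * (m + 2) * (m + 2 + 1)) ≤
      2 ^ d * ((d + 1).factorial) ^ 2 := by
    have q1 : (m + 3).factorial ≤ (d + 1).factorial := Nat.factorial_le (by omega)
    have q2 : m + 2 ≤ (m + 3).factorial := le_trans (by omega) (Nat.self_le_factorial (m + 3))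
    have q3 : (m + 3).factorial = (m + 3) * (m + 2).factorial := Nat.factorial_succ (m + 2)
    have q4 : 2 ^ (m + 2) ≤ 2 ^ d := Nat.pow_le_pow_right (by norm_num) hk
    calc (m + 2).factorial * (2 ^ (m + 2) * (m + 2) * (m + 2 + 1))
        = 2 ^ (m + 2) * ((m + 3).factorial * (m + 2)) := by rw [q3]; ring
      _ ≤ 2 ^ d * ((d + 1).factorial * (d + 1).factorial) :=
        Nat.mul_le_mul q4 (Nat.mul_le_mul q1 (q2.trans q1))
      _ = _ := by ring
  have n2 : ((m + 2).factorial : ℝ) * (2 ^ (m + 2) * ((m + 2 : ℕ) : ℝ) * (((m + 2 : ℕ) : ℝ) + 1)) ≤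
      2 ^ d * ((d + 1).factorial : ℝ) ^ 2 := by exact_mod_cast n1
  set K := 2 ^ d * ((d + 1).factorial : ℝ) ^ 2 with hK
  have hK0 : 0 < K := by positivity
  have hηK : K * η = β ^ (d - 1) * ε := by rw [hη]; field_simp
  calc _ = ((m + 2).factorial : ℝ) * (2 ^ (m + 2) * ((m + 2 : ℕ) : ℝ) * (((m + 2 : ℕ) : ℝ) + 1)) *
        (((m + 2 : ℕ) : ℝ) * η * W0) := by ring
    _ ≤ K * (((m + 2 : ℕ) : ℝ) * η * W0) := mul_le_mul_of_nonneg_right n2 (by positivity)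
    _ = (K * η) * (((m + 2 : ℕ) : ℝ) * W0) := by ring
    _ = β ^ (d - 1) * (ε * ((m + 2 : ℕ) : ℝ) * W0) := by rw [hηK]; ring
    _ ≤ β ^ (m + 1) * (ε * ((m + 2 : ℕ) : ℝ) * W0) :=
      mul_le_mul_of_nonneg_right b1 (by positivity)
    _ = _ := by ring
end

section
/- Let X be a d-dimensional simplicial complex and G an abelian group. For any f ∈ C^k(X;G) with 1 ≤ k ≤ d−1, if f is not locally minimal then there exist a vertex v ∈ X(0) and a (k−1)-cochain g ∈ C^{k−1}(X;G) such that ‖g‖ ≤ k·‖{v}‖ and ‖f − δ(g)‖ < ‖f‖. -/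
/- Common framework: weighted simplicial complexes, links, localizations,
   local spectral expansion, cochains, coboundaries, minimality, etc. -/

open Finset

open scoped Classical

namespace HDX
theorem signLemma {n : ℕ} (π : Equiv.Perm (Fin (n+1))) (i : Fin (n+1)) :
    ∃ π' : Equiv.Perm (Fin n), (∀ j, π (i.succAbove j) = (π i).succAbove (π' j)) ∧
      ((Equiv.Perm.sign π' : ℤˣ) : ℤ) * (-1) ^ (i : ℕ) = ((Equiv.Perm.sign π : ℤˣ) : ℤ) * (-1) ^ ((π i : Fin (n+1)) : ℕ) := by
  set ρ : Equiv.Perm (Fin (n+1)) := (π i).cycleRange * π * (i.cycleRange)⁻¹ with hρ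
  have h0 : ρ 0 = 0 := by
    simp [hρ, Equiv.Perm.inv_def, Fin.cycleRange_symm_zero]
  obtain ⟨⟨p, π'⟩, hπ'⟩ := Equiv.Perm.decomposeFin.symm.surjective ρ
  have hp : p = 0 := by
    have := Equiv.Perm.decomposeFin_symm_apply_zero p π'
    rw [hπ', h0] at this; exact this.symm
  subst hp
  refine ⟨π', ?_, ?_⟩
  · intro j
    have h1 : ρ j.succ = (π' j).succ := by
      rw [← hπ']; simp
    have h2 : π (i.succAbove j) = (π i).cycleRange.symm (ρ j.succ) := by
      simp [hρ, Equiv.Perm.inv_def, Fin.cycleRange_symm_succ]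
    rw [h2, h1, Fin.cycleRange_symm_succ]
  · have hs : Equiv.Perm.sign π' = Equiv.Perm.sign ρ := by
      rw [← hπ', Equiv.Perm.decomposeFin.symm_sign]; simp
    rw [hs, hρ]
    simp only [map_mul, Fin.sign_cycleRange, Equiv.Perm.sign_inv]
    push_cast
    have : ((-1:ℤ) ^ (i:ℕ)) * (-1) ^ (i:ℕ) = 1 := by rw [← mul_pow]; simp
    linear_combination ((-1:ℤ) ^ ((π i : Fin (n+1)) : ℕ)) * ((Equiv.Perm.sign π : ℤˣ) : ℤ) * this

set_option linter.unusedSectionVars false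

variable {V : Type*} [Fintype V] [DecidableEq V] {G : Type*} [AddCommGroup G]

def Anti {m : ℕ} (f : (Fin m → V) → G) : Prop :=
  ∀ (tup : Fin m → V) (π : Equiv.Perm (Fin m)),
      f (tup ∘ π) = ((Equiv.Perm.sign π : ℤˣ) : ℤ) • f tup

def sop {m : ℕ} (c : V → ℤ) (h : (Fin m → V) → G) : (Fin (m+1) → V) → G := fun tup =>
  ∑ i : Fin (m + 1), (c (tup i) * (-1 : ℤ) ^ (i : ℕ)) • h (tup ∘ i.succAbove)

theorem anti_sop {m : ℕ} (c : V → ℤ) (h : (Fin m → V) → G) (hh : Anti h) : Anti (sop c h) := by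
  intro tup π
  unfold sop
  rw [Finset.smul_sum]
  refine Fintype.sum_equiv π _ _ ?_
  intro i
  obtain ⟨π', h1, h2⟩ := signLemma π i
  have : (tup ∘ π) ∘ i.succAbove = (tup ∘ (π i).succAbove) ∘ π' := by
    funext j; simp [h1]
  rw [this, hh, smul_smul, smul_smul]
  congr 1
  simp only [Function.comp]
  linear_combination c (tup (π i)) * h2

theorem cob_eq {m : ℕ} (h : (Fin m → V) → G) : cob h = sop (fun _ => 1) h := by
  funext tup; simp [cob, sop]

theorem mem_link (X : Finset (Finset V)) (v : V) (τ : Finset V) :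
    τ ∈ link X {v} ↔ v ∉ τ ∧ insert v τ ∈ X := by
  unfold link localize
  simp only [Finset.mem_image, Finset.mem_filter, Finset.singleton_subset_iff]
  constructor
  · rintro ⟨σ, ⟨h1, h2⟩, rfl⟩
    refine ⟨by simp, ?_⟩
    convert h1
    ext x; by_cases hx : x = v <;> simp [hx, h2]
  · rintro ⟨h1, h2⟩
    refine ⟨insert v τ, ⟨h2, by simp⟩, ?_⟩
    ext x; by_cases hx : x = v <;> simp [hx, h1]

/-- every tuple whose image contains `v` can be permuted to start with `v` -/
theorem exists_perm_cons {m : ℕ} (tup : Fin (m+1) → V) (i : Fin (m+1)) :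
    tup ∘ (i.cycleRange.symm : Equiv.Perm (Fin (m+1))) = Fin.cons (tup i) (tup ∘ i.succAbove) := by
  funext j
  refine Fin.cases ?_ (fun j => ?_) j
  · simp
  · simp

theorem image_cons {m : ℕ} (v : V) (τ : Fin m → V) :
    Finset.image (Fin.cons v τ : Fin (m+1) → V) Finset.univ = insert v (Finset.image τ Finset.univ) := by
  ext x; simp [Fin.exists_fin_succ, eq_comm]

theorem supp_link {m : ℕ} (X : Finset (Finset V)) (v : V) (F : (Fin (m+1) → V) → G)
    (hF : Anti F) (τ : Finset V) (hv : v ∉ τ) :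
    insert v τ ∈ suppC X F ↔ τ ∈ suppC (link X {v}) (localizeC F v) := by
  simp only [suppC, facesCard, Finset.mem_filter, mem_link, hv, Finset.card_insert_of_notMem hv]
  simp only [not_false_eq_true, true_and, add_left_inj, and_assoc]
  refine and_congr_right fun hX => and_congr_right fun hc => ?_
  constructor
  · rintro ⟨tup, h1, h2⟩
    have : v ∈ Finset.image tup Finset.univ := by simp [h1]
    obtain ⟨i, -, hi⟩ := Finset.mem_image.1 this
    have hinj : Function.Injective tup := by
      have := (Finset.card_image_iff (s := Finset.univ) (f := tup)).1
        (by rw [h1, Finset.card_insert_of_notMem hv, hc]; simp)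
      simpa using this
    have hp := exists_perm_cons tup i
    refine ⟨tup ∘ i.succAbove, ?_, ?_⟩
    · have h3 : v ∉ Finset.image (tup ∘ i.succAbove) Finset.univ := by
        simp only [Finset.mem_image, Finset.mem_univ, true_and, Function.comp, not_exists]
        intro j hj
        exact Fin.succAbove_ne i j (hinj (hj.trans hi.symm))
      have h4 : insert v (Finset.image (tup ∘ i.succAbove) Finset.univ) = insert v τ := by
        rw [← hi, ← image_cons, ← hp, hi, ← h1]
        ext x
        simp only [Finset.mem_image, Finset.mem_univ, true_and, Function.comp]
        exact (i.cycleRange.symm).exists_congr_left.trans (by simp)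
      rw [← Finset.erase_insert h3, h4, Finset.erase_insert hv]
    · unfold localizeC
      rw [← hi, ← hp, hF]
      intro h5
      apply h2
      rcases Int.units_eq_one_or (Equiv.Perm.sign (i.cycleRange.symm)) with h | h <;>
        simpa [h] using h5
  · rintro ⟨tup, h1, h2⟩
    exact ⟨Fin.cons v tup, by rw [image_cons, h1], h2⟩

theorem sop_cons {m : ℕ} (v : V) (h : (Fin m → V) → G) (τ : Fin m → V)
    (hv : ∀ j, τ j ≠ v) :
    sop (fun x => if x = v then -1 else 0) h (Fin.cons v τ) = - h τ := by
  unfold sop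
  rw [Fin.sum_univ_succ]
  simp only [Fin.cons_zero, Fin.cons_succ, hv, if_true, if_false, zero_mul, zero_smul,
    Finset.sum_const_zero, add_zero]
  have : (Fin.cons v τ : Fin (m+1) → V) ∘ (0 : Fin (m+1)).succAbove = τ := by
    funext j; simp
  rw [this]; simp

theorem sop_zero {m : ℕ} (v : V) (h : (Fin m → V) → G) (τ : Fin (m+1) → V)
    (hv : ∀ j, τ j ≠ v) :
    sop (fun x => if x = v then -1 else 0) h τ = 0 := by
  unfold sop
  simp [hv]

theorem cob_sop_cons {m : ℕ} (v : V) (h : (Fin m → V) → G) (τ : Fin (m+1) → V)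
    (hv : ∀ j, τ j ≠ v) :
    cob (sop (fun x => if x = v then -1 else 0) h) (Fin.cons v τ) = cob h τ := by
  unfold cob
  rw [Fin.sum_univ_succ]
  have : (Fin.cons v τ : Fin (m+2) → V) ∘ (0 : Fin (m+2)).succAbove = τ := by
    funext j; simp
  rw [this, sop_zero v h τ hv, smul_zero, zero_add]
  refine Finset.sum_congr rfl fun i _ => ?_
  have : (Fin.cons v τ : Fin (m+2) → V) ∘ (i.succ).succAbove = Fin.cons v (τ ∘ i.succAbove) := by
    funext j
    refine Fin.cases ?_ (fun j => ?_) j <;> simp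
  rw [this, sop_cons v h (τ ∘ i.succAbove) (fun j => hv _)]
  simp [pow_succ]

theorem cob_sop_zero {m : ℕ} (v : V) (h : (Fin m → V) → G) (τ : Fin (m+2) → V)
    (hv : ∀ j, τ j ≠ v) :
    cob (sop (fun x => if x = v then -1 else 0) h) τ = 0 := by
  unfold cob
  refine Finset.sum_eq_zero fun i _ => ?_
  rw [sop_zero v h (τ ∘ i.succAbove) (fun j => hv _), smul_zero]

theorem cochain_sop {m : ℕ} (X : Finset (Finset V)) (v : V) (h : (Fin m → V) → G)
    (hh : IsCochain (link X {v}) h) :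
    IsCochain X (sop (fun x => if x = v then -1 else 0) h) := by
  refine ⟨anti_sop _ h hh.1, ?_⟩
  intro tup ht
  unfold sop
  refine Finset.sum_eq_zero fun i _ => ?_
  by_cases hi : tup i = v
  · rw [hh.2, smul_zero]
    rintro ⟨h1, h2⟩
    rw [mem_link] at h2
    apply ht
    have hp := exists_perm_cons tup i
    have hinj : Function.Injective (Fin.cons (tup i) (tup ∘ i.succAbove) : Fin (m+1) → V) := by
      rw [Fin.cons_injective_iff]
      refine ⟨?_, h1⟩
      rw [hi]
      rintro ⟨j, hj⟩
      exact h2.1 (Finset.mem_image.2 ⟨j, Finset.mem_univ _, hj⟩)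
    constructor
    · rw [← hp] at hinj
      simpa using hinj
    · have := h2.2
      rw [← hi, ← image_cons, ← hp] at this
      convert this using 1
      ext x
      simp only [Finset.mem_image, Finset.mem_univ, true_and, Function.comp]
      exact ((i.cycleRange.symm).exists_congr_left.trans (by simp)).symm
  · simp [hi]

noncomputable def num (Y : Finset (Finset V)) (t m : ℕ) (A : Finset (Finset V)) : ℝ :=
  ∑ σ ∈ facesCard Y t, (((σ.powersetCard m).filter (· ∈ A)).card : ℝ)

theorem card_split (v : V) (σ : Finset V) (hv : v ∉ σ) (n : ℕ) (A B : Finset (Finset V))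
    (hAB : ∀ τ, v ∉ τ → (insert v τ ∈ A ↔ τ ∈ B)) :
    (((insert v σ).powersetCard (n+1)).filter (fun τ => v ∈ τ ∧ τ ∈ A)).card
      = ((σ.powersetCard n).filter (· ∈ B)).card := by
  symm
  refine Finset.card_bij (fun τ _ => insert v τ) ?_ ?_ ?_
  · intro τ hτ
    simp only [Finset.mem_filter, Finset.mem_powersetCard] at hτ ⊢
    have h : v ∉ τ := fun h => hv (hτ.1.1 h)
    exact ⟨⟨Finset.insert_subset_insert _ hτ.1.1, by
      rw [Finset.card_insert_of_notMem h, hτ.1.2]⟩, by simp, (hAB τ h).2 hτ.2⟩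
  · intro a ha b hb hab
    simp only [Finset.mem_filter, Finset.mem_powersetCard] at ha hb
    have h1 : v ∉ a := fun h => hv (ha.1.1 h)
    have h2 : v ∉ b := fun h => hv (hb.1.1 h)
    rw [← Finset.erase_insert h1, hab, Finset.erase_insert h2]
  · intro τ hτ
    simp only [Finset.mem_filter, Finset.mem_powersetCard] at hτ
    obtain ⟨⟨h1, h2⟩, h3, h4⟩ := hτ
    have h5 := Finset.insert_erase h3
    refine ⟨τ.erase v, ?_, h5⟩
    simp only [Finset.mem_filter, Finset.mem_powersetCard]
    refine ⟨⟨?_, ?_⟩, ?_⟩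
    · rw [← Finset.erase_insert hv]; exact Finset.erase_subset_erase _ h1
    · rw [Finset.card_erase_of_mem h3, h2]; rfl
    · rw [← hAB _ (by simp), h5]; exact h4

theorem num_split (X : Finset (Finset V)) (v : V) (t n : ℕ) (A B : Finset (Finset V))
    (hAB : ∀ τ, v ∉ τ → (insert v τ ∈ A ↔ τ ∈ B)) :
    num X (t+1) (n+1) A = num X (t+1) (n+1) (A.filter (fun τ => v ∉ τ)) +
      num (link X {v}) t n B := by
  have key : num (link X {v}) t n B = ∑ σ ∈ facesCard X (t+1),
      (((σ.powersetCard (n+1)).filter (fun τ => v ∈ τ ∧ τ ∈ A)).card : ℝ) := by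
    unfold num
    rw [← Finset.sum_filter_add_sum_filter_not (facesCard X (t+1)) (fun σ => v ∈ σ)]
    have h0 : ∑ σ ∈ (facesCard X (t+1)).filter (fun σ => ¬ v ∈ σ),
      (((σ.powersetCard (n+1)).filter (fun τ => v ∈ τ ∧ τ ∈ A)).card : ℝ) = 0 := by
      refine Finset.sum_eq_zero fun σ hσ => ?_
      rw [Nat.cast_eq_zero, Finset.card_eq_zero, Finset.filter_eq_empty_iff]
      intro τ hτ h
      exact (Finset.mem_filter.1 hσ).2 ((Finset.mem_powersetCard.1 hτ).1 h.1)
    rw [h0, add_zero]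
    refine Finset.sum_bij (fun σ _ => insert v σ) ?_ ?_ ?_ ?_
    · intro σ hσ
      simp only [facesCard, Finset.mem_filter, mem_link] at hσ ⊢
      exact ⟨⟨hσ.1.2, by rw [Finset.card_insert_of_notMem hσ.1.1, hσ.2]⟩, by simp⟩
    · intro a ha b hb hab
      simp only [facesCard, Finset.mem_filter, mem_link] at ha hb
      rw [← Finset.erase_insert ha.1.1, hab, Finset.erase_insert hb.1.1]
    · intro σ hσ
      simp only [facesCard, Finset.mem_filter] at hσ
      refine ⟨σ.erase v, ?_, Finset.insert_erase hσ.2⟩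
      simp only [facesCard, Finset.mem_filter, mem_link]
      refine ⟨⟨by simp, by rw [Finset.insert_erase hσ.2]; exact hσ.1.1⟩, ?_⟩
      rw [Finset.card_erase_of_mem hσ.2, hσ.1.2]; rfl
    · intro σ hσ
      simp only [facesCard, Finset.mem_filter, mem_link] at hσ
      rw [card_split v σ hσ.1.1 n A B hAB]
  rw [key]
  unfold num
  rw [← Finset.sum_add_distrib]
  refine Finset.sum_congr rfl fun σ _ => ?_
  rw [← Nat.cast_add]
  congr 1
  rw [← Finset.card_union_of_disjoint]
  · congr 1
    ext τ
    simp only [Finset.mem_filter, Finset.mem_union]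
    tauto
  · rw [Finset.disjoint_left]
    intro τ h1 h2
    simp only [Finset.mem_filter] at h1 h2
    tauto

theorem norm_bound {m d : ℕ} (X : Finset (Finset V)) (v : V) (A : Finset (Finset V))
    (hA : ∀ τ ∈ A, v ∈ τ) :
    wt X (d+1) (m+1) A ≤ ((m : ℝ) + 1) * wt X (d+1) 1 {({v} : Finset V)} := by
  have e1 : ∀ σ ∈ facesCard X (d+1), (((σ.powersetCard (m+1)).filter (· ∈ A)).card : ℝ) ≤
      (if v ∈ σ then (d.choose m : ℝ) else 0) := by
    intro σ hσ
    have hc := (Finset.mem_filter.1 hσ).2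
    split_ifs with hv
    · norm_cast
      have := card_split v (σ.erase v) (by simp) m (Finset.univ.filter (fun τ => v ∈ τ))
        Finset.univ (by simp)
      rw [Finset.insert_erase hv] at this
      simp only [Finset.mem_univ, Finset.filter_true, Finset.card_powersetCard,
        Finset.card_erase_of_mem hv, hc, Nat.add_sub_cancel] at this
      rw [← this]
      refine Finset.card_le_card ?_
      intro τ
      simp only [Finset.mem_filter, Finset.mem_univ, true_and]
      rintro ⟨h1, h2⟩
      exact ⟨h1, hA τ h2, hA τ h2⟩
    · apply le_of_eq
      rw [Nat.cast_eq_zero, Finset.card_eq_zero, Finset.filter_eq_empty_iff]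
      intro τ hτ h
      exact hv ((Finset.mem_powersetCard.1 hτ).1 (hA τ h))
  have e2 : ∀ σ ∈ facesCard X (d+1),
      (if v ∈ σ then (1 : ℝ) else 0) ≤
      (((σ.powersetCard 1).filter (· ∈ ({({v} : Finset V)} : Finset (Finset V)))).card : ℝ) := by
    intro σ hσ
    split_ifs with hv
    · norm_cast
      rw [Nat.one_le_iff_ne_zero, ← Nat.pos_iff_ne_zero, Finset.card_pos]
      exact ⟨{v}, by simp [hv]⟩
    · positivity
  unfold wt
  rw [Nat.choose_one_right]
  have s1 := Finset.sum_le_sum e1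
  have s2 := Finset.sum_le_sum e2
  set S := ∑ σ ∈ facesCard X (d+1), (if v ∈ σ then (1 : ℝ) else 0) with hS
  have s3 : ∑ σ ∈ facesCard X (d+1), (if v ∈ σ then (d.choose m : ℝ) else 0)
      = (d.choose m : ℝ) * S := by
    rw [hS, Finset.mul_sum]; simp
  rw [s3] at s1
  have hS0 : 0 ≤ S := Finset.sum_nonneg fun σ _ => by split_ifs <;> norm_num
  have hN : (0:ℝ) ≤ ((facesCard X (d+1)).card : ℝ) := by positivity
  refine (div_le_div_of_nonneg_right s1 (by positivity)).trans ?_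
  refine le_trans ?_ (mul_le_mul_of_nonneg_left (div_le_div_of_nonneg_right s2 (by positivity))
    (by positivity))
  rcases hN.eq_or_lt with h | h
  · rw [← h]; simp
  have hch : ((d:ℝ)+1) * (d.choose m : ℝ) = ((d+1).choose (m+1) : ℝ) * ((m:ℝ)+1) := by
    exact_mod_cast Nat.add_one_mul_choose_eq d m
  rcases (Nat.zero_le ((d+1).choose (m+1))).eq_or_lt with h' | h'
  · rw [← h']; simp; positivity
  have h'' : (0:ℝ) < ((d+1).choose (m+1) : ℝ) := by exact_mod_cast h'
  apply le_of_eq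
  push_cast
  field_simp
  linear_combination S * hch

end HDX

/-- One step of correction, abelian: if `f ∈ C^k(X;G)` (`1 ≤ k ≤ d-1`,
here `k = m+1`) is not locally minimal, then there are a vertex `v ∈ X(0)` and
`g ∈ C^(k-1)(X;G)` with `‖g‖ ≤ k·‖{v}‖` and `‖f - δ(g)‖ < ‖f‖`. -/
theorem stmt5 {V : Type*} [Fintype V] [DecidableEq V] {G : Type*} [AddCommGroup G]
    (X : Finset (Finset V)) (d : ℕ) (hX : HDX.IsComplex X) (hXd : HDX.IsPureDim X d)
    (m : ℕ) (hk : m + 2 ≤ d)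
    (f : (Fin (m + 2) → V) → G) (hf : HDX.IsCochain X f)
    (hnm : ¬HDX.IsLocallyMinimal X (d + 1) f) :
    ∃ v : V, ({v} : Finset V) ∈ X ∧ ∃ g : (Fin (m + 1) → V) → G, HDX.IsCochain X g ∧
      HDX.normC X (d + 1) g ≤ ((m : ℝ) + 1) * HDX.wt X (d + 1) 1 {({v} : Finset V)} ∧
      HDX.normC X (d + 1) (fun tup => f tup - HDX.cob g tup) < HDX.normC X (d + 1) f := by
  unfold HDX.IsLocallyMinimal HDX.IsMinimal at hnm
  push Not at hnm
  obtain ⟨v, hvX, h, hh, hlt⟩ := hnm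
  set g : (Fin (m + 1) → V) → G := HDX.sop (fun x => if x = v then -1 else 0) h with hg
  have hgc : HDX.IsCochain X g := HDX.cochain_sop X v h hh
  refine ⟨v, hvX, g, hgc, ?_, ?_⟩
  · refine HDX.norm_bound X v _ ?_
    intro τ hτ
    simp only [HDX.suppC, Finset.mem_filter] at hτ
    obtain ⟨-, tup, h1, h2⟩ := hτ
    by_contra hv
    apply h2
    refine HDX.sop_zero v h tup ?_
    rintro j rfl
    exact hv (h1 ▸ Finset.mem_image_of_mem _ (Finset.mem_univ _))
  · have hF : HDX.Anti (fun tup => f tup - HDX.cob g tup) := by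
      intro tup π
      have h1 := hf.1 tup π
      have h2 := HDX.anti_sop (fun _ => 1) g hgc.1 tup π
      rw [← HDX.cob_eq] at h2
      simp only [h1, h2, smul_sub]
    have e1 := HDX.num_split X v d (m+1) _ _ (HDX.supp_link X v f hf.1)
    have e2 := HDX.num_split X v d (m+1) _ _ (HDX.supp_link X v _ hF)
    have e3 : (HDX.suppC X (fun tup => f tup - HDX.cob g tup)).filter (fun τ => v ∉ τ)
        = (HDX.suppC X f).filter (fun τ => v ∉ τ) := by
      ext τ
      simp only [HDX.suppC, Finset.mem_filter, and_assoc]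
      refine and_congr_right fun _ => ?_
      rw [and_comm, and_comm (b := v ∉ τ)]
      refine and_congr_right fun hv => ?_
      refine exists_congr fun tup => and_congr_right fun h1 => ?_
      rw [hg, HDX.cob_sop_zero v h tup, sub_zero]
      rintro j rfl
      exact hv (h1 ▸ Finset.mem_image_of_mem _ (Finset.mem_univ _))
    have e4 : HDX.suppC (HDX.link X {v})
        (HDX.localizeC (fun tup => f tup - HDX.cob g tup) v)
        = HDX.suppC (HDX.link X {v}) (fun tup => HDX.localizeC f v tup - HDX.cob h tup) := by
      ext τ
      simp only [HDX.suppC, HDX.facesCard, Finset.mem_filter, HDX.mem_link]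
      refine and_congr_right fun hv => ?_
      refine exists_congr fun tup => and_congr_right fun h1 => ?_
      unfold HDX.localizeC
      simp only [hg]
      rw [HDX.cob_sop_cons v h tup]
      rintro j rfl
      exact hv.1.1 (h1 ▸ Finset.mem_image_of_mem _ (Finset.mem_univ _))
    rw [e3, e4] at e2
    have hlt' : HDX.num (HDX.link X {v}) d (m+1)
          (HDX.suppC (HDX.link X {v}) (fun tup => HDX.localizeC f v tup - HDX.cob h tup))
        < HDX.num (HDX.link X {v}) d (m+1)
          (HDX.suppC (HDX.link X {v}) (HDX.localizeC f v)) := by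
      by_contra hcon
      push Not at hcon
      refine absurd hlt (not_lt.2 ?_)
      exact div_le_div_of_nonneg_right hcon (by positivity)
    have hlt2 : HDX.num X (d+1) (m+2) (HDX.suppC X (fun tup => f tup - HDX.cob g tup))
        < HDX.num X (d+1) (m+2) (HDX.suppC X f) := by
      refine lt_of_eq_of_lt e2 (lt_of_lt_of_eq ?_ e1.symm)
      linarith
    refine div_lt_div_of_pos_right hlt2 ?_
    have hN : 0 < (HDX.facesCard X (d+1)).card := by
      rw [Finset.card_pos]
      obtain ⟨τ, h1, -, h2⟩ := hXd.2.2 _ hvX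
      exact ⟨τ, by simp [HDX.facesCard, h1, h2]⟩
    have hC : 0 < (d+1).choose (m+2) := Nat.choose_pos (by omega)
    positivity
end
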